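/- arXiv:2402.08497 — 9 statements merged into one kernel-verified Lean document; each statement's English description precedes it below -/
import Mathlib

section
/- Let F be a finite field, m ≥ 2, let Sp_{2m}(F) be the group of 2m×2m matrices M over F with M·J·Mᵀ = J where J = [[0, I_m],[−I_m, 0]], and let PSp_{2m}(q) = Sp_{2m}(F)/Z(Sp_{2m}(F)). Then for every g ∈ PSp_{2m}(q) with g ≠ 1, there exist k ≤ 12 and elements z₁,…,z_k of PSp_{2m}(q), each of which is conjugate in PSp_{2m}(q) to g or to g⁻¹, such that the product z₁z₂⋯z_k has order exactly 2. -/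
/-- The projective symplectic group `PSp_{2m}(F) = Sp_{2m}(F)/Z(Sp_{2m}(F))`. -/
abbrev PSp (m : ℕ) (F : Type*) [Field F] [Fintype F] :=
  ↥(Matrix.symplecticGroup (Fin m) F) ⧸
    Subgroup.center ↥(Matrix.symplecticGroup (Fin m) F)

open scoped commutatorElement

/-! ### Products of conjugates of an element and its inverse -/

/-- `y` is a product of `n` elements, each conjugate to `g` or to `g⁻¹`. -/
def IsConjProd {G : Type*} [Group G] (g : G) (n : ℕ) (y : G) : Prop :=
  ∃ z : Fin n → G, (∀ i, IsConj g (z i) ∨ IsConj g⁻¹ (z i)) ∧ (List.ofFn z).prod = y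

namespace IsConjProd

variable {G H : Type*} [Group G] [Group H] {g y y' : G} {n n' : ℕ}

theorem self (g : G) : IsConjProd g 1 g :=
  ⟨fun _ => g, fun _ => Or.inl (IsConj.refl g), by simp⟩

theorem self_inv (g : G) : IsConjProd g 1 g⁻¹ :=
  ⟨fun _ => g⁻¹, fun _ => Or.inr (IsConj.refl _), by simp⟩

theorem mul (h : IsConjProd g n y) (h' : IsConjProd g n' y') :
    IsConjProd g (n + n') (y * y') := by
  obtain ⟨z, hz, rfl⟩ := h
  obtain ⟨z', hz', rfl⟩ := h'
  refine ⟨Fin.append z z', fun i => ?_, by rw [List.ofFn_fin_append, List.prod_append]⟩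
  induction i using Fin.addCases with
  | left i => simpa using hz i
  | right i => simpa using hz' i

theorem map (h : IsConjProd g n y) (f : G →* H) : IsConjProd (f g) n (f y) := by
  obtain ⟨z, hz, rfl⟩ := h
  refine ⟨f ∘ z, fun i => ?_, by simp [map_list_prod, List.map_ofFn]⟩
  rw [← map_inv]
  exact (hz i).imp f.map_isConj f.map_isConj

theorem conj (h : IsConjProd g n y) (x : G) : IsConjProd g n (x * y * x⁻¹) := by
  obtain ⟨z, hz, rfl⟩ := h
  refine ⟨fun i => x * z i * x⁻¹, fun i => ?_, ?_⟩
  · have hx : IsConj (z i) (x * z i * x⁻¹) := isConj_iff.2 ⟨x, rfl⟩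
    exact (hz i).imp (fun h => h.trans hx) (fun h => h.trans hx)
  · have := map_list_prod (MulAut.conj x) (List.ofFn z)
    rw [List.map_ofFn] at this
    exact this.symm

/-- A commutator `⁅g, t⁆` is a product of a conjugate of `g` and a conjugate of `g⁻¹`. -/
theorem commutator (g t : G) : IsConjProd g 2 ⁅g, t⁆ := by
  have h := (self g).mul ((self_inv g).conj t)
  rwa [show g * (t * g⁻¹ * t⁻¹) = ⁅g, t⁆ by simp [commutatorElement_def, mul_assoc]] at h

theorem commutator_inv (g t : G) : IsConjProd g 2 ⁅g, t⁆⁻¹ := by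
  have h := ((self g).conj t).mul (self_inv g)
  rwa [show t * g * t⁻¹ * g⁻¹ = ⁅g, t⁆⁻¹ by simp [commutatorElement_def, mul_assoc]] at h

end IsConjProd

/-! ### A commutator of trace zero in `SL₂` -/

section SpecialLinear

open Polynomial in
theorem exists_quadratic_add_quadratic_eq_zero {F : Type*} [Field F] [Fintype F]
    (h2 : (2 : F) ≠ 0) {a a' : F} (ha : a ≠ 0) (ha' : a' ≠ 0) (b c b' c' : F) :
    ∃ x y : F, a * x ^ 2 + b * x + c + (a' * y ^ 2 + b' * y + c') = 0 := by
  have hF : ringChar F ≠ 2 := fun h => h2 (by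
    have := ringChar.Nat.cast_ringChar (R := F)
    rw [h] at this
    exact_mod_cast this)
  obtain ⟨x, y, hxy⟩ := FiniteField.exists_root_sum_quadratic
    (degree_quadratic (b := b) (c := c) ha) (degree_quadratic (b := b') (c := c') ha')
    (FiniteField.odd_card_of_char_ne_two hF)
  exact ⟨x, y, by simpa using hxy⟩

namespace Matrix.SpecialLinearGroup

variable {F : Type*} [Field F]

/-- The unipotent upper triangular matrix with off-diagonal entry `s`. -/
def upper (s : F) : SpecialLinearGroup (Fin 2) F := ⟨!![1, s; 0, 1], by simp⟩

/-- The unipotent lower triangular matrix with off-diagonal entry `s`. -/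
def lower (s : F) : SpecialLinearGroup (Fin 2) F := ⟨!![1, 0; s, 1], by simp⟩

theorem exists_commutator_sq_eq_neg_one [Fintype F] (h2 : (2 : F) ≠ 0) :
    ∃ x : SpecialLinearGroup (Fin 2) F, ⁅lower (2 : F) * upper 2, x⁆ * ⁅lower (2 : F) * upper 2, x⁆ = -1 := by
  have h8 : (-8 : F) ≠ 0 := by
    rw [show (-8 : F) = -(2 ^ 3) by norm_num]
    exact neg_ne_zero.2 (pow_ne_zero 3 h2)
  obtain ⟨w, Z, hwZ⟩ := exists_quadratic_add_quadratic_eq_zero h2 one_ne_zero h8 0 34 0 0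
  obtain ⟨X, rfl⟩ : ∃ X, w = X - 3 * Z := ⟨w + 3 * Z, by ring⟩
  obtain ⟨k, hk⟩ : ∃ k, Z - 5 * X = 2 * k := ⟨(Z - 5 * X) / 2, by field_simp⟩
  obtain ⟨p', q, hpq⟩ := exists_quadratic_add_quadratic_eq_zero h2
    (neg_ne_zero.2 one_ne_zero) h2 X (-1) (-X - k) 0
  obtain ⟨p, rfl⟩ : ∃ p, p' = p + q := ⟨p' - q, by ring⟩
  obtain ⟨r, hr⟩ : ∃ r, r = k + 2 * p - q := ⟨_, rfl⟩
  obtain ⟨s, hs⟩ : ∃ s, s = X - p := ⟨_, rfl⟩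
  have hdet : p * s - q * r = 1 := by
    subst hr hs
    linear_combination hpq
  let x : SpecialLinearGroup (Fin 2) F := ⟨!![p, q; r, s], by rw [det_fin_two_of, hdet]⟩
  refine ⟨x, ?_⟩
  obtain ⟨y, hy⟩ : ∃ y, y = ⁅lower (2 : F) * upper 2, x⁆ := ⟨_, rfl⟩
  have htr : y.1 0 0 + y.1 1 1 = 0 := by
    have hyx : y.1 = !![1, 2; 2, 5] * !![p, q; r, s] * !![5, -2; -2, 1] * !![s, -q; -r, p] := by
      have hu : (lower (2 : F) * upper 2).1 = !![1, 2; 2, 5] := by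
        change !![1, 0; 2, 1] * !![1, 2; 0, 1] = _
        norm_num
      have hux : y.1 = (lower (2 : F) * upper 2).1 * x.1 *
          (lower (2 : F) * upper 2).1.adjugate * x.1.adjugate := by rw [hy]; rfl
      rw [hux, hu, adjugate_fin_two_of]
      simp [x, adjugate_fin_two_of]
    obtain rfl : X = p + s := by rw [hs]; ring
    obtain rfl : Z = p + 2 * r + 2 * q + 5 * s := by linear_combination hk - 2 * hr
    rw [hyx]
    simp
    linear_combination hwZ + 34 * hdet
  rw [← hy]
  have hd := y.2
  rw [det_fin_two] at hd
  ext i j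
  fin_cases i <;> fin_cases j <;> simp [Matrix.mul_apply, Fin.sum_univ_two]
  · linear_combination y.1 0 0 * htr - hd
  · linear_combination y.1 0 1 * htr
  · linear_combination y.1 1 0 * htr
  · linear_combination y.1 1 1 * htr - hd

end Matrix.SpecialLinearGroup

end SpecialLinear

/-! ### The symplectic form -/

namespace SymplecticGroup

open Matrix

section Form

variable {l F : Type*} [DecidableEq l] [Fintype l] [Field F]

/-- The standard symplectic form on column vectors. -/
def form : (l ⊕ l → F) →ₗ[F] (l ⊕ l → F) →ₗ[F] F := Matrix.toLinearMap₂' F (J l F)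

theorem form_apply (x y : l ⊕ l → F) : form x y = x ⬝ᵥ J l F *ᵥ y :=
  Matrix.toLinearMap₂'_apply' _ _ _

theorem form_swap (x y : l ⊕ l → F) : form x y = -form y x := by
  rw [form_apply, form_apply, dotProduct_comm, ← vecMul_transpose, J_transpose, vecMul_neg,
    neg_dotProduct, ← dotProduct_mulVec]

theorem form_self (x : l ⊕ l → F) : form x x = 0 := by
  rw [form_apply, dotProduct, Fintype.sum_sum_type, J, fromBlocks_mulVec]
  simp [neg_mulVec, mul_comm]

theorem form_eq_zero_of_forall {x : l ⊕ l → F} (h : ∀ y, form y x = 0) : x = 0 := by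
  have hJ : J l F *ᵥ x = 0 := dotProduct_eq_zero _ fun y => by
    rw [dotProduct_comm, ← form_apply, h]
  have := congrArg (J l F *ᵥ ·) hJ
  simpa [J_squared, neg_mulVec] using this

theorem form_mulVec (A : symplecticGroup l F) (x y : l ⊕ l → F) :
    form (A.1 *ᵥ x) (A.1 *ᵥ y) = form x y := by
  rw [form_apply, form_apply, ← vecMul_transpose, ← dotProduct_mulVec, mulVec_mulVec,
    mulVec_mulVec, mem_iff'.1 A.2]

theorem ext_mulVec {A B : symplecticGroup l F} (h : ∀ x, A.1 *ᵥ x = B.1 *ᵥ x) : A = B :=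
  Subtype.ext (Matrix.mulVec_injective (funext h))

theorem mul_mulVec (A B : symplecticGroup l F) (x : l ⊕ l → F) :
    (A * B).1 *ᵥ x = A.1 *ᵥ B.1 *ᵥ x := by
  rw [mulVec_mulVec]; rfl

theorem one_mulVec' (x : l ⊕ l → F) : (1 : symplecticGroup l F).1 *ᵥ x = x :=
  one_mulVec x

/-- The symplectic matrix of a linear map preserving the symplectic form. -/
def ofLinear (f : (l ⊕ l → F) →ₗ[F] (l ⊕ l → F))
    (hf : ∀ x y, form (f x) (f y) = form x y) :
    symplecticGroup l F :=
  ⟨LinearMap.toMatrix' f, mem_iff'.2 <| (Matrix.toLinearMap₂' F (S₁ := F) (S₂ := F)).injective <| by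
    refine LinearMap.ext₂ fun x y => ?_
    have := hf x y
    rw [form_apply, form_apply] at this
    rw [Matrix.toLinearMap₂'_apply', Matrix.toLinearMap₂'_apply', ← this, ← mulVec_mulVec,
      ← mulVec_mulVec, dotProduct_mulVec, vecMul_transpose]
    simp [LinearMap.toMatrix'_mulVec]⟩

@[simp]
theorem ofLinear_mulVec (f : (l ⊕ l → F) →ₗ[F] (l ⊕ l → F))
    (hf : ∀ x y, form (f x) (f y) = form x y) (x : l ⊕ l → F) :
    (ofLinear f hf).1 *ᵥ x = f x := by
  simp [ofLinear, LinearMap.toMatrix'_mulVec]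

/-- The symplectic transvection `x ↦ x + a ω(u, x) u`. -/
def transvection (u : l ⊕ l → F) (a : F) : symplecticGroup l F :=
  ofLinear (LinearMap.id + (a • form u).smulRight u) fun x y => by
    simp [form_self, form_swap x u]
    ring

theorem transvection_mulVec (u : l ⊕ l → F) (a : F) (x : l ⊕ l → F) :
    (transvection u a).1 *ᵥ x = x + (a * form u x) • u := by
  simp [transvection]

theorem transvection_mul_transvection (u : l ⊕ l → F) (a b : F) :
    transvection u a * transvection u b = transvection u (a + b) := by
  refine ext_mulVec fun x => ?_
  simp only [mul_mulVec, transvection_mulVec, map_add, map_smul, form_self, smul_eq_mul]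
  module

theorem transvection_zero (u : l ⊕ l → F) : transvection u 0 = 1 :=
  ext_mulVec fun x => by simp [transvection_mulVec]

theorem transvection_inv (u : l ⊕ l → F) (a : F) :
    (transvection u a)⁻¹ = transvection u (-a) := by
  rw [inv_eq_iff_mul_eq_one, transvection_mul_transvection, add_neg_cancel, transvection_zero]

theorem conj_transvection (A : symplecticGroup l F) (u : l ⊕ l → F) (a : F) :
    A * transvection u a * A⁻¹ = transvection (A.1 *ᵥ u) a := by
  rw [mul_inv_eq_iff_eq_mul]
  refine ext_mulVec fun x => ?_
  simp only [mul_mulVec, transvection_mulVec, form_mulVec, mulVec_add, mulVec_smul]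

theorem commutator_transvection (A : symplecticGroup l F) (u : l ⊕ l → F) (a : F) :
    ⁅A, transvection u a⁆ = transvection (A.1 *ᵥ u) a * transvection u (-a) := by
  rw [commutatorElement_def, conj_transvection, transvection_inv]

theorem transvection_commute {u v : l ⊕ l → F} (h : form u v = 0) (a b : F) :
    Commute (transvection u a) (transvection v b) := by
  have h' : form v u = 0 := by rw [form_swap, h, neg_zero]
  refine ext_mulVec fun x => ?_
  simp only [mul_mulVec, transvection_mulVec, map_add, map_smul, h, h', smul_eq_mul]
  module

/-- A central symplectic matrix fixing a nonzero vector is trivial. -/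
theorem eq_one_of_mem_center {A : symplecticGroup l F}
    (hA : A ∈ Subgroup.center (symplecticGroup l F)) {z : l ⊕ l → F} (hz : z ≠ 0)
    (hAz : A.1 *ᵥ z = z) : A = 1 := by
  have key : ∀ u, form u z ≠ 0 → A.1 *ᵥ u = u := fun u hu => by
    have h := congrArg (fun B : symplecticGroup l F => B.1 *ᵥ z)
      (Subgroup.mem_center_iff.1 hA (transvection u 1))
    simp only [mul_mulVec, transvection_mulVec, hAz, mulVec_add, mulVec_smul, one_mul,
      add_right_inj] at h
    exact (smul_right_injective _ hu h).symm
  obtain ⟨w, hw⟩ : ∃ w, form w z ≠ 0 := by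
    by_contra! h
    exact hz (form_eq_zero_of_forall h)
  refine ext_mulVec fun u => ?_
  rw [one_mulVec']
  by_cases hu : form u z = 0
  · have h := key (u + w) (by simpa [hu] using hw)
    rw [mulVec_add, key w hw] at h
    exact add_right_cancel h
  · exact key u hu

/-- A symplectic matrix mapping every vector to an orthogonal one is an involution. -/
theorem mul_self_eq_one_of_form_eq_zero {A : symplecticGroup l F}
    (h : ∀ v, form v (A.1 *ᵥ v) = 0) : A * A = 1 := by
  refine ext_mulVec fun x => ?_
  rw [one_mulVec', mul_mulVec, ← sub_eq_zero]
  refine form_eq_zero_of_forall fun y => ?_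
  obtain ⟨y, rfl⟩ : ∃ v, y = A.1 *ᵥ v :=
    ⟨A⁻¹.1 *ᵥ y, by rw [← mul_mulVec, mul_inv_cancel, one_mulVec']⟩
  have h1 := h (x + y)
  simp only [mulVec_add, map_add, LinearMap.add_apply, h] at h1
  rw [map_sub, form_mulVec, form_swap (A.1 *ᵥ y) x]
  linear_combination h1

theorem exists_ne_zero_form_eq_zero (hl : 2 ≤ Fintype.card l) (e f : l ⊕ l → F) :
    ∃ z ≠ 0, form e z = 0 ∧ form f z = 0 := by
  have h := LinearMap.ker_ne_bot_of_finrank_lt (f := (form e).prod (form f)) (by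
    simp only [Module.finrank_prod, Module.finrank_self, Module.finrank_fintype_fun_eq_card,
      Fintype.card_sum]
    omega)
  obtain ⟨z, hz, hz0⟩ := Submodule.exists_mem_ne_zero_of_ne_bot h
  exact ⟨z, hz0, by simpa using hz⟩

/-- The action of a `2 × 2` matrix on the hyperbolic plane spanned by `e` and `f`, extended by the
identity on its orthogonal complement. -/
def planeMap (e f : l ⊕ l → F) (M : Matrix (Fin 2) (Fin 2) F) :
    (l ⊕ l → F) →ₗ[F] (l ⊕ l → F) :=
  LinearMap.id +
    ((form e f)⁻¹ • (M 0 1 • form e - (M 0 0 - 1) • form f)).smulRight e +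
    ((form e f)⁻¹ • ((M 1 1 - 1) • form e - M 1 0 • form f)).smulRight f

theorem planeMap_apply (e f : l ⊕ l → F) (M : Matrix (Fin 2) (Fin 2) F) (x : l ⊕ l → F) :
    planeMap e f M x = x +
      ((form e f)⁻¹ * (M 0 1 * form e x - (M 0 0 - 1) * form f x)) • e +
      ((form e f)⁻¹ * ((M 1 1 - 1) * form e x - M 1 0 * form f x)) • f := by
  simp [planeMap]

theorem form_planeMap {e f : l ⊕ l → F} (hef : form e f ≠ 0)
    (M : SpecialLinearGroup (Fin 2) F) (x y : l ⊕ l → F) :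
    form (planeMap e f M.1 x) (planeMap e f M.1 y) = form x y := by
  have hd := M.2
  rw [det_fin_two] at hd
  simp only [planeMap_apply, map_add, map_smul, LinearMap.add_apply, LinearMap.smul_apply,
    smul_eq_mul, form_self, form_swap f e, form_swap x e, form_swap x f]
  field_simp
  linear_combination form e f * (form e x * form f y - form f x * form e y) * hd

/-- The embedding of `SL₂` into the symplectic group given by a hyperbolic plane. -/
def planeHom {e f : l ⊕ l → F} (hef : form e f ≠ 0) :
    SpecialLinearGroup (Fin 2) F →* symplecticGroup l F where
  toFun M := ofLinear (planeMap e f M.1) (form_planeMap hef M)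
  map_one' := ext_mulVec fun x => by simp [planeMap_apply]
  map_mul' M N := ext_mulVec fun x => by
    have hMN : ∀ i j, (M * N).1 i j = M.1 i 0 * N.1 0 j + M.1 i 1 * N.1 1 j := fun i j => by
      rw [← Fin.sum_univ_two fun k => M.1 i k * N.1 k j]
      exact Matrix.mul_apply
    simp only [mul_mulVec, ofLinear_mulVec, planeMap_apply, map_add, map_smul, form_self,
      form_swap f e, hMN]
    match_scalars <;> field_simp <;> ring

theorem planeHom_mulVec {e f : l ⊕ l → F} (hef : form e f ≠ 0)
    (M : SpecialLinearGroup (Fin 2) F) (x : l ⊕ l → F) :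
    (planeHom hef M).1 *ᵥ x = planeMap e f M.1 x :=
  ofLinear_mulVec (planeMap e f M.1) (form_planeMap hef M) x

theorem planeHom_upper {e f : l ⊕ l → F} (hef : form e f ≠ 0) (s : F) :
    planeHom hef (.upper s) = transvection e (s / form e f) :=
  ext_mulVec fun x => by
    rw [planeHom_mulVec, planeMap_apply, transvection_mulVec]
    simp only [SpecialLinearGroup.upper, of_apply, cons_val_zero, cons_val_one]
    match_scalars <;> field_simp <;> simp

theorem planeHom_lower {e f : l ⊕ l → F} (hef : form e f ≠ 0) (s : F) :
    planeHom hef (.lower s) = transvection f (-s / form e f) :=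
  ext_mulVec fun x => by
    rw [planeHom_mulVec, planeMap_apply, transvection_mulVec]
    simp only [SpecialLinearGroup.lower, of_apply, cons_val_zero, cons_val_one]
    match_scalars <;> field_simp <;> simp

end Form

section Involution

variable {l F : Type*} [DecidableEq l] [Fintype l] [Field F]

/-- In odd characteristic, eight conjugates suffice to produce a noncentral involution. -/
theorem exists_isConjProd_of_two_ne_zero [Fintype F] (hl : 2 ≤ Fintype.card l)
    (h2 : (2 : F) ≠ 0) {A : symplecticGroup l F} {v : l ⊕ l → F}
    (hv : form v (A.1 *ᵥ v) ≠ 0) :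
    ∃ Y, IsConjProd A 8 Y ∧ Y * Y = 1 ∧ Y ∉ Subgroup.center (symplecticGroup l F) := by
  obtain ⟨x, hx⟩ := SpecialLinearGroup.exists_commutator_sq_eq_neg_one h2
  set φ := planeHom hv
  set h : SpecialLinearGroup (Fin 2) F := .lower 2 * .upper 2
  have hφ : φ h = ⁅A, transvection v (-2 / form v (A.1 *ᵥ v))⁆ := by
    rw [commutator_transvection, map_mul, planeHom_lower, planeHom_upper, neg_div, neg_neg]
  have hH : IsConjProd A 2 (φ h) := hφ ▸ IsConjProd.commutator _ _
  have hH' : IsConjProd A 2 (φ h)⁻¹ := hφ ▸ IsConjProd.commutator_inv _ _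
  have hC : IsConjProd A 4 (φ ⁅h, x⁆) := by
    have := hH.mul (hH'.conj (φ x))
    rwa [show φ h * (φ x * (φ h)⁻¹ * (φ x)⁻¹) = φ ⁅h, x⁆ by
      simp [commutatorElement_def, mul_assoc]] at this
  refine ⟨φ (-1), by rw [← hx, map_mul]; exact hC.mul hC, by simp [← map_mul], fun hc => ?_⟩
  obtain ⟨z, hz, hvz, hAz⟩ := exists_ne_zero_form_eq_zero hl v (A.1 *ᵥ v)
  have h1 : φ (-1) = 1 := eq_one_of_mem_center hc hz (by
    simp [φ, planeHom_mulVec, planeMap_apply, hvz, hAz])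
  have h3 := congrArg (fun B : symplecticGroup l F => form (B.1 *ᵥ v) (A.1 *ᵥ v)) h1
  simp only [φ, planeHom_mulVec, planeMap_apply, one_mulVec'] at h3
  have h4 : (-1 - 1 : F) ≠ 0 := by
    rw [show (-1 - 1 : F) = -2 by norm_num]
    exact neg_ne_zero.2 h2
  simp [form_self, form_swap (A.1 *ᵥ v) v, hv, h4] at h3

/-- In characteristic two, four conjugates suffice to produce a noncentral involution. -/
theorem exists_isConjProd_of_two_eq_zero (hl : 2 ≤ Fintype.card l)
    (h2 : (2 : F) = 0) {A : symplecticGroup l F} {v : l ⊕ l → F}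
    (hv : form v (A.1 *ᵥ v) ≠ 0) :
    ∃ Y, IsConjProd A 4 Y ∧ Y * Y = 1 ∧ Y ∉ Subgroup.center (symplecticGroup l F) := by
  have hneg : (-1 : F) = 1 := by linear_combination -h2
  have hsq : ∀ u : l ⊕ l → F, transvection u (1 : F) * transvection u 1 = 1 := fun u => by
    rw [transvection_mul_transvection, one_add_one_eq_two, h2, transvection_zero]
  obtain ⟨z, hz, hvz, hfz⟩ := exists_ne_zero_form_eq_zero hl v (A.1 *ᵥ v)
  set f := A.1 *ᵥ v
  have hfv : form f v ≠ 0 := by rwa [form_swap, neg_ne_zero]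
  set w := v + form f v • z with hw
  have hzf : form z f = 0 := by rw [form_swap, hfz, neg_zero]
  have hzv : form z v = 0 := by rw [form_swap, hvz, neg_zero]
  let R : symplecticGroup l F := transvection (f + z) 1 * (transvection f 1 * transvection z 1)
  have hRf : R.1 *ᵥ f = f := by
    simp only [R, mul_mulVec, transvection_mulVec, form_self, hzf, map_add, LinearMap.add_apply,
      mul_zero, zero_smul, add_zero]
  have hRv : R.1 *ᵥ v = w := by
    simp only [R, mul_mulVec, transvection_mulVec, form_self, hzf, hzv, map_add, map_smul,
      LinearMap.add_apply, one_mul, zero_smul, add_zero, smul_eq_mul, mul_zero]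
    rw [hw]
    match_scalars
    · ring
    · linear_combination form f v * h2
    · ring
  have hH : ⁅A, transvection v 1⁆ = transvection f 1 * transvection v 1 := by
    rw [commutator_transvection, hneg]
  have hY : IsConjProd A 4 (transvection v 1 * transvection w 1) := by
    have := (IsConjProd.commutator_inv A (transvection v 1)).mul
      ((IsConjProd.commutator A (transvection v 1)).conj R)
    have hc : R * (transvection f 1 * transvection v 1) * R⁻¹ =
        transvection f 1 * transvection w 1 := by
      rw [← hRv, ← conj_transvection R v]
      nth_rw 2 [← hRf]
      rw [← conj_transvection R f]
      group
    rw [hH, hc, _root_.mul_inv_rev, transvection_inv, transvection_inv, hneg, mul_assoc,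
      ← mul_assoc (transvection f 1), hsq, one_mul] at this
    exact this
  have hvw : form v w = 0 := by simp [hw, form_self, hvz]
  have hwv : form w v = 0 := by rw [form_swap, hvw, neg_zero]
  refine ⟨_, hY, ?_, fun hc => hz ?_⟩
  · rw [mul_assoc, ← mul_assoc (transvection w 1),
      (transvection_commute hwv 1 1).eq, mul_assoc, hsq, mul_one, hsq]
  · have hv0 : v ≠ 0 := by
      intro h
      simp [h] at hv
    have h1 := eq_one_of_mem_center hc hv0 (by
      simp only [mul_mulVec, transvection_mulVec, form_self, hwv, mul_zero, zero_smul, add_zero])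
    have h3 := congrArg (fun B : symplecticGroup l F => B.1 *ᵥ f)
      (mul_eq_one_iff_eq_inv.1 h1)
    have hwf : form w f = form v f := by simp [hw, hzf]
    simp only [transvection_inv, hneg, transvection_mulVec, one_mul, hwf, add_right_inj] at h3
    have h4 : v = w := smul_right_injective _ hv h3
    simpa [hw, hfv] using h4

end Involution

end SymplecticGroup

open SymplecticGroup in
theorem stmt_5 {F : Type*} [Field F] [Fintype F] {m : ℕ} (hm : 2 ≤ m)
    (g : PSp m F) (hg : g ≠ 1) :
    ∃ k ≤ 12, ∃ z : Fin k → PSp m F,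
      (∀ i, IsConj g (z i) ∨ IsConj g⁻¹ (z i)) ∧ orderOf (List.ofFn z).prod = 2 := by
  obtain ⟨A, rfl⟩ := QuotientGroup.mk_surjective g
  have hl : 2 ≤ Fintype.card (Fin m) := by simpa using hm
  obtain ⟨k, hk, Y, hY, hY2, hYc⟩ : ∃ k ≤ 12, ∃ Y, IsConjProd A k Y ∧ Y * Y = 1 ∧
      Y ∉ Subgroup.center (Matrix.symplecticGroup (Fin m) F) := by
    by_cases hA : ∀ v, form v (A.1.mulVec v) = 0
    · exact ⟨1, by norm_num, A, .self A, mul_self_eq_one_of_form_eq_zero hA,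
        fun h => hg ((QuotientGroup.eq_one_iff A).2 h)⟩
    · push Not at hA
      obtain ⟨v, hv⟩ := hA
      by_cases h2 : (2 : F) = 0
      · exact ⟨4, by norm_num, exists_isConjProd_of_two_eq_zero hl h2 hv⟩
      · exact ⟨8, by norm_num, exists_isConjProd_of_two_ne_zero hl h2 hv⟩
  obtain ⟨z, hz, hzY⟩ := hY.map (QuotientGroup.mk' (Subgroup.center _))
  refine ⟨k, hk, z, hz, ?_⟩
  rw [hzY]
  refine orderOf_eq_prime ?_ fun h => hYc ((QuotientGroup.eq_one_iff Y).1 h)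
  rw [sq, ← map_mul, hY2, map_one]
end

section
/- Let n ≥ 5 and let g be a nonidentity permutation in the symmetric group S_n. If it is not the case that n = 5 and g is a 5-cycle, then there exists h in the alternating group A_n such that the commutator [g,h] = g⁻¹h⁻¹gh has order exactly 2. -/
open Equiv Equiv.Perm

theorem conj_inv_swap {α : Type*} [DecidableEq α] (g : Perm α) (a b : α) :
    g⁻¹ * swap (g a) (g b) * g = swap a b := by
  rw [mul_assoc, ← mul_swap_eq_swap_mul, inv_mul_cancel_left]

theorem orderOf_swap_mul_swap {α : Type*} [DecidableEq α] {a b c d : α} (hab : a ≠ b)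
    (hac : a ≠ c) (had : a ≠ d) (hbc : b ≠ c) (hbd : b ≠ d) :
    orderOf (swap a b * swap c d) = 2 := by
  refine orderOf_eq_prime ?_ ?_
  · have hcomm : Commute (swap a b) (swap c d) := by
      ext x
      simp only [Perm.mul_apply, swap_apply_def]
      grind
    rw [hcomm.mul_pow, pow_two, pow_two, swap_mul_self, swap_mul_self, one_mul]
  · intro h
    have := congrArg (fun p : Perm α => p a) h
    simp only [Perm.mul_apply, swap_apply_of_ne_of_ne hac had, swap_apply_left,
      Perm.one_apply] at this
    exact hab this.symm

theorem swap_mul_swap_mem_alternatingGroup {α : Type*} [DecidableEq α] [Fintype α]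
    {a b c d : α} (hab : a ≠ b) (hcd : c ≠ d) :
    swap a b * swap c d ∈ alternatingGroup α := by
  rw [Perm.mem_alternatingGroup, Perm.sign_mul, sign_swap hab, sign_swap hcd]
  rfl

theorem commutator_swap_mul_swap {α : Type*} [DecidableEq α] (g : Perm α) (a b c d : α) :
    g⁻¹ * (swap (g a) (g b) * swap (g c) (g d))⁻¹ * g * (swap (g a) (g b) * swap (g c) (g d)) =
      swap c d * swap a b * swap (g a) (g b) * swap (g c) (g d) := by
  rw [← conj_inv_swap g a b, ← conj_inv_swap g c d, mul_inv_rev, swap_inv, swap_inv]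
  group

section

variable {α : Type*} [DecidableEq α] [Fintype α] (g : Perm α)

theorem exists_orderOf_commutator_of_fixed {x w : α} (hx : g x = x) (hw : g (g w) ≠ w) :
    ∃ h ∈ alternatingGroup α, orderOf (g⁻¹ * h⁻¹ * g * h) = 2 := by
  have hw1 : g w ≠ w := fun h => hw (by rw [h, h])
  have hxw : x ≠ w := by rintro rfl; exact hw1 hx
  have hxy : x ≠ g w := fun h => hxw (g.injective (hx.trans h))
  have hxz : x ≠ g (g w) := fun h => hxy (g.injective (hx.trans h))
  have hyz : g w ≠ g (g w) := fun h => hw1 (g.injective h).symm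
  refine ⟨swap (g x) (g w) * swap (g w) (g (g w)),
    swap_mul_swap_mem_alternatingGroup (g.injective.ne hxw) hyz, ?_⟩
  rw [commutator_swap_mul_swap, hx]
  convert orderOf_swap_mul_swap hxw hxy hxz hw1.symm hw.symm using 2
  ext u
  simp only [Perm.mul_apply, swap_apply_def]
  grind

theorem exists_orderOf_commutator_of_two_cycle {x w : α} (hx : g x ≠ x) (hxx : g (g x) = x)
    (hw : g w ≠ w) (hwx : w ≠ x) (hwy : w ≠ g x) :
    ∃ h ∈ alternatingGroup α, orderOf (g⁻¹ * h⁻¹ * g * h) = 2 := by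
  have hzy : g w ≠ g x := g.injective.ne hwx
  have hzx : g w ≠ x := fun h => hwy (g.injective (h.trans hxx.symm))
  refine ⟨swap (g (g x)) (g x) * swap (g x) (g w),
    swap_mul_swap_mem_alternatingGroup (hxx.symm ▸ hx.symm) hzy.symm, ?_⟩
  rw [commutator_swap_mul_swap, hxx, swap_comm (g x) x, mul_assoc (swap x w), swap_mul_self,
    mul_one]
  exact orderOf_swap_mul_swap hwx.symm hx.symm hzx.symm hwy hw.symm

theorem exists_orderOf_commutator_of_isSwap (hα : 4 ≤ Fintype.card α) (hg : g.IsSwap) :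
    ∃ h ∈ alternatingGroup α, orderOf (g⁻¹ * h⁻¹ * g * h) = 2 := by
  obtain ⟨x, y, hxy, rfl⟩ := hg
  obtain ⟨u, hu⟩ := Finset.exists_mem_notMem_of_card_lt_card
    (s := {x, y}) (t := Finset.univ) (by grind [Finset.card_le_two, Finset.card_univ])
  obtain ⟨v, hv⟩ := Finset.exists_mem_notMem_of_card_lt_card
    (s := {x, y, u}) (t := Finset.univ) (by grind [Finset.card_le_three, Finset.card_univ])
  simp only [Finset.mem_univ, true_and, Finset.mem_insert, Finset.mem_singleton, not_or] at hu hv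
  obtain ⟨hux, huy⟩ := hu
  obtain ⟨hvx, hvy, hvu⟩ := hv
  refine ⟨swap x u * swap y v, swap_mul_swap_mem_alternatingGroup (Ne.symm hux) (Ne.symm hvy), ?_⟩
  convert orderOf_swap_mul_swap hxy (Ne.symm hux) (Ne.symm hvx) (Ne.symm huy) (Ne.symm hvy) using 2
  ext w
  simp only [mul_inv_rev, swap_inv, Perm.mul_apply, swap_apply_def]
  grind

theorem exists_orderOf_commutator_of_no_short_cycle (hα : 6 ≤ Fintype.card α)
    (h1 : ∀ x, g x ≠ x) (h2 : ∀ x, g (g x) ≠ x) :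
    ∃ h ∈ alternatingGroup α, orderOf (g⁻¹ * h⁻¹ * g * h) = 2 := by
  obtain ⟨x⟩ : Nonempty α := Fintype.card_pos_iff.mp (by lia)
  obtain ⟨u, -, hu⟩ := Finset.exists_mem_notMem_of_card_lt_card
    (s := {x, g x, g (g x), g⁻¹ x, g⁻¹ (g⁻¹ x)}) (t := Finset.univ)
    (by grind [Finset.card_le_five, Finset.card_univ])
  simp only [Finset.mem_insert, Finset.mem_singleton, not_or, Perm.eq_inv_iff_eq] at hu
  obtain ⟨hu0, hu1, hu2, hu3, hu4⟩ := hu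
  have hinj : ∀ {a b : α}, a ≠ b → g a ≠ g b := fun h => g.injective.ne h
  refine ⟨swap (g x) (g u) * swap (g (g x)) (g (g u)),
    swap_mul_swap_mem_alternatingGroup (hinj (Ne.symm hu0)) (hinj (hinj (Ne.symm hu0))), ?_⟩
  rw [commutator_swap_mul_swap]
  convert orderOf_swap_mul_swap (Ne.symm hu0) (h2 x).symm (Ne.symm hu4) hu2 (h2 u).symm using 2
  have := h1 x
  have := h1 u
  have := hinj hu1
  have := hinj hu3
  have := hinj hu0
  ext v
  simp only [Perm.mul_apply, swap_apply_def]
  grind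

theorem cycleType_eq_singleton_five (hα : Fintype.card α = 5)
    (h1 : ∀ x, g x ≠ x) (h2 : ∀ x, g (g x) ≠ x) : g.cycleType = {5} := by
  have hsum : g.cycleType.sum = 5 := by
    rw [sum_cycleType, ← hα, Finset.card_eq_iff_eq_univ]
    ext x
    simp [h1 x]
  have hge : ∀ k ∈ g.cycleType, 3 ≤ k := by
    intro k hk
    refine lt_of_le_of_ne (two_le_of_mem_cycleType hk) ?_
    rintro rfl
    obtain ⟨c, τ, rfl, hd, -, hc⟩ := mem_cycleType_iff.mp hk
    obtain ⟨x, y, hxy, rfl⟩ := card_support_eq_two.mp hc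
    have hx : τ x = x := (hd x).resolve_left (by simpa using hxy.symm)
    have hy : τ y = y := (hd y).resolve_left (by simpa using hxy)
    exact h2 x (by simp [hx, hy])
  obtain h0 | ⟨a, ha⟩ := g.cycleType.empty_or_exists_mem
  · simp [h0] at hsum
  obtain ⟨s, hs⟩ := Multiset.exists_cons_of_mem ha
  obtain rfl | ⟨b, hb⟩ := s.empty_or_exists_mem
  · rw [hs] at hsum ⊢
    simpa using hsum
  · obtain ⟨t, rfl⟩ := Multiset.exists_cons_of_mem hb
    rw [hs] at hsum hge
    have := hge a (by simp)
    have := hge b (by simp)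
    simp only [Multiset.sum_cons] at hsum
    lia

end

theorem stmt_6 {n : ℕ} (hn : 5 ≤ n) (g : Equiv.Perm (Fin n)) (hg : g ≠ 1)
    (h5 : ¬(n = 5 ∧ g.cycleType = {5})) :
    ∃ h ∈ alternatingGroup (Fin n), orderOf (g⁻¹ * h⁻¹ * g * h) = 2 := by
  by_cases hfix : ∃ x, g x = x
  · obtain ⟨x, hx⟩ := hfix
    by_cases hinv : ∃ w, g (g w) ≠ w
    · obtain ⟨w, hw⟩ := hinv
      exact exists_orderOf_commutator_of_fixed g hx hw
    push Not at hinv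
    obtain ⟨y, hy⟩ : ∃ y, g y ≠ y := by
      by_contra! h
      exact hg (Perm.ext h)
    by_cases hz : ∃ z, g z ≠ z ∧ z ≠ y ∧ z ≠ g y
    · obtain ⟨z, hz, hzy, hzy'⟩ := hz
      exact exists_orderOf_commutator_of_two_cycle g hy (hinv y) hz hzy hzy'
    refine exists_orderOf_commutator_of_isSwap g (by simpa using by lia)
      ⟨y, g y, hy.symm, Perm.ext fun z => ?_⟩
    have := hinv y
    rw [swap_apply_def]
    grind
  · push Not at hfix
    by_cases hinv : ∃ x, g (g x) = x
    · obtain ⟨x, hx⟩ := hinv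
      obtain ⟨z, -, hz⟩ := Finset.exists_mem_notMem_of_card_lt_card
        (s := {x, g x}) (t := Finset.univ)
        (by grind [Finset.card_le_two, Finset.card_univ, Fintype.card_fin])
      simp only [Finset.mem_insert, Finset.mem_singleton, not_or] at hz
      exact exists_orderOf_commutator_of_two_cycle g (hfix x) hx (hfix z) hz.1 hz.2
    push Not at hinv
    refine exists_orderOf_commutator_of_no_short_cycle g ?_ hfix hinv
    rw [Fintype.card_fin]
    by_contra! h6
    have h : n = 5 := by lia
    exact h5 ⟨h, cycleType_eq_singleton_five g (by simpa using h) hfix hinv⟩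
end

section
/- Let n ≥ 6 and let g be a nonidentity element of the alternating group A_n. Then there exist elements x and y of A_n, each of which is conjugate in A_n to g or to g⁻¹, such that the product xy has order exactly 2. (Equivalently, d(Inv(A_n)) ≤ 2: for every nonidentity conjugacy class C of A_n, the set (C ∪ C⁻¹)² contains an involution.) -/
open Equiv Equiv.Perm

/-- If the commutator of `g` with an even product of two transpositions is a product of two disjoint
transpositions, then it exhibits an involution as a product of conjugates of `g` and `g⁻¹`. -/
theorem exists_conj_mul_involution_of_swaps {α : Type*} [Fintype α] [DecidableEq α]
    (g : alternatingGroup α) {a b c d p q r s : α} (hab : a ≠ b) (hcd : c ≠ d)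
    (hpq : p ≠ q) (hrs : r ≠ s) (hpr : p ≠ r) (hps : p ≠ s) (hqr : q ≠ r) (hqs : q ≠ s)
    (h : swap (g.1 a) (g.1 b) * swap (g.1 c) (g.1 d) * (swap c d * swap a b) =
      swap p q * swap r s) :
    ∃ x y : alternatingGroup α,
      (IsConj g x ∨ IsConj g⁻¹ x) ∧ (IsConj g y ∨ IsConj g⁻¹ y) ∧ orderOf (x * y) = 2 := by
  let k : alternatingGroup α := ⟨swap a b * swap c d, by
    simp [mem_alternatingGroup, sign_swap hab, sign_swap hcd]⟩
  refine ⟨g, k * g⁻¹ * k⁻¹, .inl (IsConj.refl g), .inr (isConj_iff.2 ⟨k, rfl⟩), ?_⟩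
  have hk : ((g * (k * g⁻¹ * k⁻¹) : alternatingGroup α) : Perm α) = swap p q * swap r s := by
    rw [← h, swap_apply_apply, swap_apply_apply]
    simp [k, mul_assoc]
  rw [← Subgroup.orderOf_coe, hk]
  refine orderOf_eq_prime ?_ fun h1 => ?_
  · ext x
    simp only [pow_two, Perm.mul_apply, swap_apply_def, Perm.one_apply]
    grind
  · have := congrArg (fun f : Perm α => f p) h1
    simp only [Perm.mul_apply, swap_apply_def, Perm.one_apply] at this
    grind

/-- An even permutation with a 2-cycle moves some point outside that 2-cycle. -/
theorem exists_moved_of_two_cycle {α : Type*} [Fintype α] [DecidableEq α]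
    (g : alternatingGroup α) {a : α} (h1 : g.1 a ≠ a) (h2 : g.1 (g.1 a) = a) :
    ∃ c, c ≠ a ∧ c ≠ g.1 a ∧ g.1 c ≠ c := by
  by_contra! H
  have hg : g.1 = swap a (g.1 a) := by
    ext x
    simp only [swap_apply_def]
    grind
  have hs : sign g.1 = 1 := g.2
  rw [hg, sign_swap h1.symm] at hs
  exact absurd hs (by decide)

theorem stmt_7 {n : ℕ} (hn : 6 ≤ n) (g : ↥(alternatingGroup (Fin n))) (hg : g ≠ 1) :
    ∃ x y : ↥(alternatingGroup (Fin n)),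
      (IsConj g x ∨ IsConj g⁻¹ x) ∧ (IsConj g y ∨ IsConj g⁻¹ y) ∧ orderOf (x * y) = 2 := by
  have inj : ∀ x y, g.1 x = g.1 y → x = y := fun x y h => g.1.injective h
  by_cases h2 : ∃ a, g.1 a ≠ a ∧ g.1 (g.1 a) = a
  · obtain ⟨a, hb, ha⟩ := h2
    obtain ⟨c, hca, hcb, hc⟩ := exists_moved_of_two_cycle g hb ha
    have hda : g.1 c ≠ a := by grind
    have hdb : g.1 c ≠ g.1 a := by grind
    refine exists_conj_mul_involution_of_swaps g (a := a) (b := c) (c := c) (d := g.1 a)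
      (p := a) (q := g.1 c) (r := g.1 a) (s := c) (by grind) (by grind) (by grind) (by grind)
      (by grind) (by grind) (by grind) (by grind) ?_
    ext x
    simp only [Perm.mul_apply, swap_apply_def]
    grind
  · push Not at h2
    by_cases h1 : ∃ p, g.1 p = p
    · obtain ⟨p, hp⟩ := h1
      obtain ⟨a, ha⟩ : ∃ a, g.1 a ≠ a := by
        by_contra! H
        exact hg (Subtype.ext (Equiv.ext H))
      have hca := h2 a ha
      have hpa : p ≠ a := by grind
      have hpb : p ≠ g.1 a := by grind
      have hpc : p ≠ g.1 (g.1 a) := by grind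
      have hbc : g.1 a ≠ g.1 (g.1 a) := by grind
      refine exists_conj_mul_involution_of_swaps g (a := p) (b := a) (c := a) (d := g.1 a)
        (p := p) (q := g.1 (g.1 a)) (r := a) (s := g.1 a) (by grind) (by grind) (by grind)
        (by grind) (by grind) (by grind) (by grind) (by grind) ?_
      ext x
      simp only [Perm.mul_apply, swap_apply_def]
      grind
    · push Not at h1
      let a : Fin n := ⟨0, by omega⟩
      obtain ⟨c, hc⟩ : ∃ c, c ∉ ({a, g.1 a, g.1 (g.1 a), g.1.symm a, g.1.symm (g.1.symm a)} :
          Finset (Fin n)) := by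
        by_contra! H
        have := (Finset.card_le_card fun x (_ : x ∈ Finset.univ) => H x).trans Finset.card_le_five
        simp at this
        omega
      simp only [Finset.mem_insert, Finset.mem_singleton, not_or, Equiv.eq_symm_apply] at hc
      obtain ⟨hca, hcb, hce, hda, hfa⟩ := hc
      have ha := h1 a
      have hc := h1 c
      have ha2 := h2 a ha
      have hc2 := h2 c hc
      have hbd : g.1 a ≠ g.1 c := by grind
      refine exists_conj_mul_involution_of_swaps g (a := a) (b := c) (c := g.1 a) (d := g.1 c)
        (p := g.1 (g.1 a)) (q := g.1 (g.1 c)) (r := a) (s := c) (by grind) (by grind) (by grind)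
        (by grind) (by grind) (by grind) (by grind) (by grind) ?_
      have hcomm : Commute (swap (g.1 a) (g.1 c)) (swap (g.1 (g.1 a)) (g.1 (g.1 c))) :=
        (disjoint_swap_swap (by simp; grind)).commute
      rw [hcomm.eq, mul_assoc, swap_mul_self_mul]
end

section
/- Let g be a nonidentity element of the alternating group A_5. Then there exist k ≤ 3 and elements z₁,…,z_k of A_5, each of which is conjugate in A_5 to g or to g⁻¹, such that the product z₁⋯z_k has order exactly 2. (Equivalently, d(Inv(A_5)) ≤ 3.) -/
open Equiv Equiv.Perm in
/-- A nontrivial even permutation of five points is conjugate, in the full symmetric group, to a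
product of two disjoint transpositions, to a 3-cycle or to a 5-cycle. -/
theorem isConj_of_mem_alternatingGroup_five {g : Perm (Fin 5)}
    (hg : g ∈ alternatingGroup (Fin 5)) (hne : g ≠ 1) :
    IsConj (swap 0 4 * swap 1 3) g ∨ IsConj (swap 0 1 * swap 0 2) g ∨ IsConj (finRotate 5) g := by
  have htwo : ∀ m ∈ g.cycleType, 2 ≤ m := fun m hm => two_le_of_mem_cycleType hm
  have hsum : g.cycleType.sum ≤ 5 := by
    simpa [sum_cycleType] using g.support.card_le_univ
  rw [mem_alternatingGroup, sign_of_cycleType] at hg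
  rw [Ne, ← cycleType_eq_zero] at hne
  rw [isConj_iff_cycleType_eq, isConj_iff_cycleType_eq, isConj_iff_cycleType_eq,
    cycleType_swap_mul_swap_of_nodup (by decide),
    cycleType_finRotate,
    (isThreeCycle_swap_mul_swap_same (by decide) (by decide) (by decide)).cycleType]
  generalize g.cycleType = c at *
  obtain ⟨n, hn⟩ := Multiset.exists_mem_of_ne_zero hne
  obtain ⟨t, rfl⟩ := Multiset.exists_cons_of_mem hn
  have hn2 := htwo n hn
  rcases t.empty_or_exists_mem with rfl | ⟨m, hm⟩
  · have hn5 : n ≤ 5 := by simpa using hsum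
    interval_cases n
    · exact absurd hg (by decide)
    · exact Or.inr (Or.inl rfl)
    · exact absurd hg (by decide)
    · exact Or.inr (Or.inr rfl)
  · have hm2 := htwo m (by simp [hm])
    obtain ⟨s, rfl⟩ := Multiset.exists_cons_of_mem hm
    simp only [Multiset.sum_cons] at hsum
    rcases s.empty_or_exists_mem with rfl | ⟨l, hl⟩
    · simp only [Multiset.sum_zero] at hsum
      obtain ⟨rfl, rfl⟩ | ⟨rfl, rfl⟩ | ⟨rfl, rfl⟩ :
        n = 2 ∧ m = 2 ∨ n = 2 ∧ m = 3 ∨ n = 3 ∧ m = 2 := by omega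
      · exact Or.inl rfl
      · exact absurd hg (by decide)
      · exact absurd hg (by decide)
    · have := htwo l (by simp [hl])
      have := Multiset.le_sum_of_mem hl
      omega

open Equiv Equiv.Perm in
theorem exists_sq_mul_conj_sq_eq_one (g : alternatingGroup (Fin 5)) (hg : g ≠ 1) :
    ∃ a : alternatingGroup (Fin 5),
      (g * g * (a * g * a⁻¹)) ^ 2 = 1 ∧ g * g * (a * g * a⁻¹) ≠ 1 := by
  let a : Perm (Fin 5) := swap 0 1 * swap 1 3
  obtain ⟨r, hr, hrg⟩ : ∃ r : Perm (Fin 5),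
      ((r * r * (a * r * a⁻¹)) ^ 2 = 1 ∧ r * r * (a * r * a⁻¹) ≠ 1) ∧ IsConj r g := by
    rcases isConj_of_mem_alternatingGroup_five g.2 (by simpa using hg) with h | h | h
    · exact ⟨_, by decide, h⟩
    · exact ⟨_, by decide, h⟩
    · exact ⟨_, by decide, h⟩
  obtain ⟨c, hc⟩ := isConj_iff.1 hrg
  refine ⟨⟨c * a * c⁻¹, by
    rw [mem_alternatingGroup, map_mul, map_mul, map_inv, mul_inv_cancel_comm]; decide⟩, ?_⟩
  rw [Ne, Subtype.ext_iff, Subtype.ext_iff]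
  have h : (g * g * (c * a * c⁻¹ * g * (c * a * c⁻¹)⁻¹) : Perm (Fin 5)) =
      c * (r * r * (a * r * a⁻¹)) * c⁻¹ := by
    rw [← hc]; group
  simp only [Subgroup.coe_pow, Subgroup.coe_mul, Subgroup.coe_inv, Subgroup.coe_one]
  rw [h, conj_pow, hr.1]
  exact ⟨by simp, fun h1 => hr.2 (conj_eq_one_iff.1 h1)⟩

theorem stmt_8 (g : ↥(alternatingGroup (Fin 5))) (hg : g ≠ 1) :
    ∃ k ≤ 3, ∃ z : Fin k → ↥(alternatingGroup (Fin 5)),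
      (∀ i, IsConj g (z i) ∨ IsConj g⁻¹ (z i)) ∧ orderOf (List.ofFn z).prod = 2 := by
  obtain ⟨a, hsq, hne⟩ := exists_sq_mul_conj_sq_eq_one g hg
  refine ⟨3, le_rfl, ![g, g, a * g * a⁻¹], fun i => Or.inl ?_, ?_⟩
  · fin_cases i
    · exact IsConj.refl g
    · exact IsConj.refl g
    · exact isConj_iff.2 ⟨a, rfl⟩
  · have h : (List.ofFn ![g, g, a * g * a⁻¹]).prod = g * g * (a * g * a⁻¹) := by
      simp [List.ofFn_succ, mul_assoc]
    rw [h]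
    exact orderOf_eq_prime hsq hne
end

section
/- Let g be a 5-cycle in the alternating group A_5 (i.e. g has cycle type a single 5-cycle). Then for all elements x and y of A_5, each of which is conjugate in A_5 to g or to g⁻¹, the product xy does not have order 2. (Hence d(Inv(A_5)) ≥ 3, and combined with the upper bound, d(Inv(A_5)) = 3.) -/
/-- If `t` is even, a product of one of the standard 5-cycles `c`, `c⁻¹` by a `t`-conjugate of
`c` or `c⁻¹` that squares to `1` is trivial. -/
theorem finRotate_mul_conj_sq_eq_one : ∀ t : Equiv.Perm (Fin 5), Equiv.Perm.sign t = 1 →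
    ∀ e f : Bool,
      (cond e (finRotate 5) (finRotate 5)⁻¹ *
        (t * cond f (finRotate 5) (finRotate 5)⁻¹ * t⁻¹)) ^ 2 = 1 →
      cond e (finRotate 5) (finRotate 5)⁻¹ *
        (t * cond f (finRotate 5) (finRotate 5)⁻¹ * t⁻¹) = 1 := by
  decide +kernel

theorem exists_eq_conj_cond_of_isConj {G : Type*} [Group G] {g x : G}
    (h : IsConj g x ∨ IsConj g⁻¹ x) : ∃ (a : G) (e : Bool), x = a * cond e g g⁻¹ * a⁻¹ := by
  rcases h with h | h <;> obtain ⟨a, rfl⟩ := isConj_iff.1 h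
  exacts [⟨a, true, rfl⟩, ⟨a, false, rfl⟩]

theorem stmt_9 (g : ↥(alternatingGroup (Fin 5)))
    (hc : (g : Equiv.Perm (Fin 5)).cycleType = {5}) :
    ∀ x y : ↥(alternatingGroup (Fin 5)),
      (IsConj g x ∨ IsConj g⁻¹ x) → (IsConj g y ∨ IsConj g⁻¹ y) → orderOf (x * y) ≠ 2 := by
  intro x y hx hy hxy
  obtain ⟨a, e, rfl⟩ := exists_eq_conj_cond_of_isConj hx
  obtain ⟨b, f, rfl⟩ := exists_eq_conj_cond_of_isConj hy
  have hconj : IsConj (finRotate 5) (g : Equiv.Perm (Fin 5)) := by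
    rw [Equiv.Perm.isConj_iff_cycleType_eq, hc, cycleType_finRotate]
  obtain ⟨s, hs⟩ := isConj_iff.1 hconj
  have hcond (i : Bool) : ((cond i g g⁻¹ : alternatingGroup (Fin 5)) : Equiv.Perm (Fin 5)) =
      s * cond i (finRotate 5) (finRotate 5)⁻¹ * s⁻¹ := by
    cases i <;> simp [← hs, mul_assoc]
  set t : Equiv.Perm (Fin 5) := s⁻¹ * ((a⁻¹ * b : alternatingGroup (Fin 5)) : _) * s with ht
  have hsign : Equiv.Perm.sign t = 1 := by
    rw [ht, map_mul, map_mul, Equiv.Perm.mem_alternatingGroup.1 (a⁻¹ * b).2, mul_one, ← map_mul,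
      inv_mul_cancel, map_one]
  have hprod : ((a * cond e g g⁻¹ * a⁻¹ * (b * cond f g g⁻¹ * b⁻¹) : alternatingGroup (Fin 5)) :
      Equiv.Perm (Fin 5)) = (a * s) * (cond e (finRotate 5) (finRotate 5)⁻¹ *
        (t * cond f (finRotate 5) (finRotate 5)⁻¹ * t⁻¹)) * (a * s)⁻¹ := by
    simp only [Subgroup.coe_mul, Subgroup.coe_inv, hcond, ht]
    group
  rw [← Subgroup.orderOf_coe, hprod] at hxy
  have hsq := hxy ▸ pow_orderOf_eq_one _
  rw [conj_pow, conj_eq_one_iff] at hsq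
  rw [finRotate_mul_conj_sq_eq_one t hsign e f hsq] at hxy
  simp at hxy
end

section
/- Let F be a finite field with |F| = q > 2, let G = GL_2(F) and S = SL_2(F). Let g ∈ G \ Z(G) and set C = g^S. Then there exist elements x₁,…,x₆ ∈ C and y₁,…,y₆ ∈ C⁻¹ such that the product x₁y₁x₂y₂x₃y₃x₄y₄x₅y₅x₆y₆ equals −I₂ if q is odd, and equals the matrix [[1,1],[0,1]] if q is even. -/
/-- The subgroup `SL_2(F)` of `GL_2(F)`, as the range of the natural embedding. -/
def SL2sub (F : Type*) [Field F] : Subgroup (GL (Fin 2) F) :=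
  (Matrix.SpecialLinearGroup.toGL (n := Fin 2) (R := F)).range

namespace ConjQuot

open Matrix

variable {F : Type*} [Field F]

lemma mem_SL2sub_iff (s : GL (Fin 2) F) : s ∈ SL2sub F ↔ s.val.det = 1 := by
  constructor
  · rintro ⟨t, rfl⟩
    exact t.2
  · intro h
    exact ⟨⟨s.val, h⟩, Units.ext rfl⟩

/-- Quotients of two `SL_2(F)`-conjugates of `g`. -/
def conjQuot (g : GL (Fin 2) F) : Set (GL (Fin 2) F) :=
  {z | ∃ s ∈ SL2sub F, ∃ r ∈ SL2sub F, z = s * g * s⁻¹ * (r * g * r⁻¹)⁻¹}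

lemma one_mem (g : GL (Fin 2) F) : 1 ∈ conjQuot g :=
  ⟨1, Subgroup.one_mem _, 1, Subgroup.one_mem _, by group⟩

lemma mem_of_mul_eq {g z s : GL (Fin 2) F} (hs : s.val.det = 1)
    (h : z.val * g.val * s.val = s.val * g.val) : z ∈ conjQuot g := by
  refine ⟨s, (mem_SL2sub_iff s).2 hs, 1, Subgroup.one_mem _, ?_⟩
  have h' : z * g * s = s * g := Units.ext h
  rw [← h']
  group

lemma conj_mem {g z s : GL (Fin 2) F} (hs : s ∈ SL2sub F) (hz : z ∈ conjQuot g) :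
    s * z * s⁻¹ ∈ conjQuot g := by
  obtain ⟨a, ha, b, hb, rfl⟩ := hz
  exact ⟨s * a, mul_mem hs ha, s * b, mul_mem hs hb, by group⟩

lemma mem_of_conj {g z w s : GL (Fin 2) F} (hs : s.val.det = 1) (hz : z ∈ conjQuot g)
    (h : w.val * s.val = s.val * z.val) : w ∈ conjQuot g := by
  have h' : w * s = s * z := Units.ext h
  rw [eq_mul_inv_of_mul_eq h']
  exact conj_mem ((mem_SL2sub_iff s).2 hs) hz

lemma SL2sub_conj {s : GL (Fin 2) F} (k : GL (Fin 2) F) (hs : s ∈ SL2sub F) :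
    k * s * k⁻¹ ∈ SL2sub F := by
  rw [mem_SL2sub_iff] at hs ⊢
  have hk : k.val.det * (k⁻¹).val.det = 1 := by
    rw [← det_mul, ← Units.val_mul, mul_inv_cancel, Units.val_one, det_one]
  rw [Units.val_mul, Units.val_mul, det_mul, det_mul, hs, mul_one, hk]

lemma conj_mem_conj {g z : GL (Fin 2) F} (k : GL (Fin 2) F) (hz : z ∈ conjQuot g) :
    k * z * k⁻¹ ∈ conjQuot (k * g * k⁻¹) := by
  obtain ⟨a, ha, b, hb, rfl⟩ := hz
  exact ⟨_, SL2sub_conj k ha, _, SL2sub_conj k hb, by group⟩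

/-- A non-scalar matrix has a cyclic vector, hence is conjugate to its companion matrix. -/
lemma exists_conj_companion (A : Matrix (Fin 2) (Fin 2) F)
    (hA : ¬ (A 0 1 = 0 ∧ A 1 0 = 0 ∧ A 0 0 = A 1 1)) :
    ∃ Q : GL (Fin 2) F, A * Q.val = Q.val * !![0, -A.det; 1, A.trace] := by
  obtain ⟨x, y, hxy⟩ : ∃ x y : F,
      x * (A 1 0 * x + A 1 1 * y) - (A 0 0 * x + A 0 1 * y) * y ≠ 0 := by
    by_contra! h
    have h1 := h 1 0
    have h2 := h 0 1
    have h3 := h 1 1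
    apply hA
    refine ⟨by linear_combination -h2, by linear_combination h1, ?_⟩
    linear_combination h1 + h2 - h3
  refine ⟨GeneralLinearGroup.mkOfDetNeZero
    !![x, A 0 0 * x + A 0 1 * y; y, A 1 0 * x + A 1 1 * y] ?_, ?_⟩
  · rw [det_fin_two_of]
    exact hxy
  · ext i j
    fin_cases i <;> fin_cases j <;>
      simp [GeneralLinearGroup.mkOfDetNeZero, mul_apply, Fin.sum_univ_two, det_fin_two,
        trace_fin_two] <;> ring

lemma exists_conj_of_trace_det_eq {A B : GL (Fin 2) F}
    (hA : ¬ (A.val 0 1 = 0 ∧ A.val 1 0 = 0 ∧ A.val 0 0 = A.val 1 1))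
    (hB : ¬ (B.val 0 1 = 0 ∧ B.val 1 0 = 0 ∧ B.val 0 0 = B.val 1 1))
    (ht : A.val.trace = B.val.trace) (hd : A.val.det = B.val.det) :
    ∃ P : GL (Fin 2) F, B * P = P * A := by
  obtain ⟨Q, hQ⟩ := exists_conj_companion A.val hA
  obtain ⟨R, hR⟩ := exists_conj_companion B.val hB
  refine ⟨R * Q⁻¹, Units.ext ?_⟩
  have hQ' : (Q⁻¹).val * A.val = !![0, -A.val.det; 1, A.val.trace] * (Q⁻¹).val := by
    calc (Q⁻¹).val * A.val = (Q⁻¹).val * (A.val * Q.val) * (Q⁻¹).val := by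
          rw [mul_assoc, mul_assoc, ← Units.val_mul Q, mul_inv_cancel, Units.val_one, mul_one]
      _ = _ := by
          rw [hQ, ← mul_assoc, ← Units.val_mul, inv_mul_cancel, Units.val_one, one_mul]
  rw [Units.val_mul B, Units.val_mul _ A, Units.val_mul R, mul_assoc R.val, hQ', ← mul_assoc, hR, ht, hd,
    mul_assoc]

lemma not_scalar {g : GL (Fin 2) F} (hg : g ∉ Subgroup.center (GL (Fin 2) F)) :
    ¬ (g.val 0 1 = 0 ∧ g.val 1 0 = 0 ∧ g.val 0 0 = g.val 1 1) := by
  rintro ⟨h1, h2, h3⟩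
  apply hg
  rw [Subgroup.mem_center_iff]
  intro h
  apply Units.ext
  ext i j
  fin_cases i <;> fin_cases j <;>
    simp [mul_apply, Fin.sum_univ_two, h1, h2, h3, mul_comm]

lemma sq_eq_neg_one {z : GL (Fin 2) F} (hd : z.val.det = 1) (ht : z.val.trace = 0) :
    z * z = -1 := by
  rw [det_fin_two] at hd
  rw [trace_fin_two] at ht
  apply Units.ext
  ext i j
  fin_cases i <;> fin_cases j <;> simp [mul_apply, Fin.sum_univ_two]
  · linear_combination z.val 0 0 * ht - hd
  · linear_combination z.val 0 1 * ht
  · linear_combination z.val 1 0 * ht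
  · linear_combination z.val 1 1 * ht - hd

lemma det_of_mem {g z : GL (Fin 2) F} (hz : z ∈ conjQuot g) : z.val.det = 1 := by
  obtain ⟨s, hs, r, hr, rfl⟩ := hz
  rw [← mem_SL2sub_iff]
  have h := mul_mem hs (SL2sub_conj g (mul_mem (inv_mem hs) hr))
  have h' := mul_mem h (inv_mem hr)
  convert h' using 1
  group

/-- `conjQuot g` contains elements of trace `2 + a² / det g`. -/
lemma exists_trace {g : GL (Fin 2) F}
    (hg : ¬ (g.val 0 1 = 0 ∧ g.val 1 0 = 0 ∧ g.val 0 0 = g.val 1 1)) (a τ : F)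
    (h : a ^ 2 = g.val.det * (τ - 2)) :
    ∃ z ∈ conjQuot g, z.val.trace = τ := by
  obtain ⟨Q, hQ⟩ := exists_conj_companion g.val hg
  have hd : g.val.det ≠ 0 := ((Matrix.isUnit_iff_isUnit_det _).1 g.isUnit).ne_zero
  set d := g.val.det
  set t := g.val.trace
  let K : GL (Fin 2) F := GeneralLinearGroup.mkOfDetNeZero !![0, -d; 1, t]
    (by rw [det_fin_two_of]; simpa using hd)
  let z : GL (Fin 2) F := GeneralLinearGroup.mkOfDetNeZero !![1 + a ^ 2 / d, a; a / d, 1]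
    (by rw [det_fin_two_of, show (1 + a ^ 2 / d) * 1 - a * (a / d) = 1 by ring]; exact one_ne_zero)
  let u : GL (Fin 2) F := GeneralLinearGroup.mkOfDetNeZero !![1, a; 0, 1]
    (by simp [det_fin_two_of])
  have hK : g = Q * K * Q⁻¹ := eq_mul_inv_of_mul_eq (Units.ext hQ)
  have hz : z ∈ conjQuot K := by
    apply mem_of_mul_eq (s := u)
    · simp [u, GeneralLinearGroup.mkOfDetNeZero, det_fin_two_of]
    · ext i j
      fin_cases i <;> fin_cases j <;>
        simp [u, z, K, GeneralLinearGroup.mkOfDetNeZero, mul_apply, Fin.sum_univ_two] <;>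
        field_simp <;> ring
  refine ⟨Q * z * Q⁻¹, hK ▸ conj_mem_conj Q hz, ?_⟩
  rw [Units.val_mul, trace_mul_comm, ← Units.val_mul, inv_mul_cancel_left]
  have : z.val.trace = 1 + a ^ 2 / d + 1 := by
    simp [z, GeneralLinearGroup.mkOfDetNeZero, trace_fin_two]
  rw [this, h]
  field_simp
  ring

/-- A binary quadratic form of nonzero discriminant over a finite field of odd order is
universal. -/
lemma exists_quadratic_eq [Fintype F] (h2 : (2 : F) ≠ 0) {t d : F} (h : t ^ 2 - 4 * d ≠ 0)
    (c : F) : ∃ x y : F, x ^ 2 + t * x * y + d * y ^ 2 = c := by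
  obtain ⟨a, b, hab⟩ := FiniteField.exists_root_sum_quadratic
    (f := (Polynomial.X ^ 2 : Polynomial F))
    (g := Polynomial.C (-(t ^ 2 - 4 * d) / 4) * Polynomial.X ^ 2 +
      Polynomial.C 0 * Polynomial.X + Polynomial.C (-c))
    (Polynomial.degree_X_pow 2)
    (Polynomial.degree_quadratic (by
      have h4 : (4 : F) ≠ 0 := by
        rw [show (4 : F) = 2 * 2 by norm_num]; exact mul_ne_zero h2 h2
      exact div_ne_zero (neg_ne_zero.2 h) h4))
    (by
      have : ringChar F ≠ 2 := fun hc => h2 (by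
        have := ringChar.Nat.cast_ringChar (R := F)
        rw [hc] at this
        exact_mod_cast this)
      exact FiniteField.odd_card_of_char_ne_two this)
  simp only [Polynomial.eval_add, Polynomial.eval_mul, Polynomial.eval_pow, Polynomial.eval_X,
    Polynomial.eval_C] at hab
  refine ⟨a - t * b / 2, b, ?_⟩
  have h4 : (4 : F) = 2 * 2 := by norm_num
  rw [h4] at hab
  field_simp at hab ⊢
  linear_combination hab

/-- If `g` has distinct eigenvalues then its `SL_2(F)`-class contains every non-scalar matrix with
the same trace and determinant. -/
lemma exists_SL2_conj [Fintype F] (h2 : (2 : F) ≠ 0) {g h : GL (Fin 2) F}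
    (hΔ : g.val.trace ^ 2 - 4 * g.val.det ≠ 0)
    (hg : ¬ (g.val 0 1 = 0 ∧ g.val 1 0 = 0 ∧ g.val 0 0 = g.val 1 1))
    (hh : ¬ (h.val 0 1 = 0 ∧ h.val 1 0 = 0 ∧ h.val 0 0 = h.val 1 1))
    (ht : g.val.trace = h.val.trace) (hd : g.val.det = h.val.det) :
    ∃ s : GL (Fin 2) F, s.val.det = 1 ∧ h * s = s * g := by
  obtain ⟨P, hP⟩ := exists_conj_of_trace_det_eq hg hh ht hd
  have hP0 : P.val.det ≠ 0 := ((Matrix.isUnit_iff_isUnit_det _).1 P.isUnit).ne_zero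
  obtain ⟨x, y, hxy⟩ := exists_quadratic_eq h2 hΔ (P.val.det)⁻¹
  have hR : (x • (1 : Matrix (Fin 2) (Fin 2) F) + y • g.val).det = (P.val.det)⁻¹ := by
    rw [← hxy, det_fin_two, det_fin_two, trace_fin_two]
    simp
    ring
  let R : GL (Fin 2) F := GeneralLinearGroup.mkOfDetNeZero _ (hR ▸ inv_ne_zero hP0)
  have hRg : R * g = g * R := by
    apply Units.ext
    simp [R, GeneralLinearGroup.mkOfDetNeZero, add_mul, mul_add]
  refine ⟨P * R, ?_, ?_⟩
  · rw [Units.val_mul, det_mul]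
    change _ * (x • (1 : Matrix (Fin 2) (Fin 2) F) + y • g.val).det = 1
    rw [hR, mul_inv_cancel₀ hP0]
  · rw [← mul_assoc, hP, mul_assoc, mul_assoc, hRg]

lemma exists_trace_eq_zero [Fintype F] (h2 : (2 : F) ≠ 0) {g : GL (Fin 2) F}
    (hg : ¬ (g.val 0 1 = 0 ∧ g.val 1 0 = 0 ∧ g.val 0 0 = g.val 1 1))
    (hΔ : g.val.trace ^ 2 - 4 * g.val.det ≠ 0) :
    ∃ z ∈ conjQuot g, z.val.trace = 0 := by
  obtain ⟨Q, hQ⟩ := exists_conj_companion g.val hg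
  have hd : g.val.det ≠ 0 := ((Matrix.isUnit_iff_isUnit_det _).1 g.isUnit).ne_zero
  set d := g.val.det
  set t := g.val.trace
  have hK0 : (!![0, -d; 1, t] : Matrix (Fin 2) (Fin 2) F).det ≠ 0 := by
    rw [det_fin_two_of]; simpa using hd
  let K : GL (Fin 2) F := GeneralLinearGroup.mkOfDetNeZero !![0, -d; 1, t] hK0
  have hKv : K.val = !![0, -d; 1, t] := rfl
  have hK : g = Q * K * Q⁻¹ := eq_mul_inv_of_mul_eq (Units.ext hQ)
  obtain ⟨α, γ, hαγ⟩ : ∃ α γ : F, α ^ 2 + t * α * γ + d * γ ^ 2 - t * α + d = 0 := by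
    obtain ⟨x, y, hxy⟩ := exists_quadratic_eq h2 hΔ (-(d * t ^ 2 / (t ^ 2 - 4 * d) + d))
    have hi := mul_inv_cancel₀ hΔ
    set i := (t ^ 2 - 4 * d)⁻¹
    rw [div_eq_mul_inv] at hxy
    refine ⟨x - 2 * d * t * i, y + t ^ 2 * i, ?_⟩
    linear_combination hxy + t * x * hi - d * t ^ 2 * i * hi
  have hh : (!![α, α * t + γ * d; γ, t - α] : Matrix (Fin 2) (Fin 2) F).det = d := by
    rw [det_fin_two_of]
    linear_combination -hαγ
  let h : GL (Fin 2) F :=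
    GeneralLinearGroup.mkOfDetNeZero !![α, α * t + γ * d; γ, t - α] (by rw [hh]; exact hd)
  have hhv : h.val = !![α, α * t + γ * d; γ, t - α] := rfl
  obtain ⟨s, hs, hsK⟩ := exists_SL2_conj h2 (g := K) (h := h)
    (by rw [hKv, trace_fin_two_of, det_fin_two_of]; simpa using hΔ)
    (by rw [hKv]; simp)
    (by
      rw [hhv]
      simp only [of_apply, cons_val', cons_val_zero, cons_val_one, cons_val_fin_one]
      rintro ⟨-, h2, h3⟩
      rw [h2] at hαγ
      exact hΔ (by linear_combination -4 * hαγ + (2 * α - t) * h3))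
    (by rw [hKv, hhv, trace_fin_two_of, trace_fin_two_of]; ring)
    (by rw [hhv, hh, hKv, det_fin_two_of]; ring)
  have hz : h * K⁻¹ ∈ conjQuot K := by
    refine ⟨s, (mem_SL2sub_iff s).2 hs, 1, Subgroup.one_mem _, ?_⟩
    rw [← hsK]; group
  refine ⟨Q * (h * K⁻¹) * Q⁻¹, hK ▸ conj_mem_conj Q hz, ?_⟩
  rw [Units.val_mul, trace_mul_comm, ← Units.val_mul, inv_mul_cancel_left, Units.val_mul,
    coe_units_inv, hKv, inv_def, adjugate_fin_two_of, det_fin_two_of, hhv]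
  simp [trace_fin_two]
  ring

/-- The upper unitriangular matrix with off-diagonal entry `c`. -/
def unip (c : F) : GL (Fin 2) F :=
  GeneralLinearGroup.mkOfDetNeZero !![1, c; 0, 1] (by simp [det_fin_two_of])

lemma unip_val (c : F) : (unip c).val = !![1, c; 0, 1] := rfl

lemma unip_mul (a b : F) : unip a * unip b = unip (a + b) := by
  apply Units.ext
  rw [Units.val_mul]
  simp only [unip_val]
  ext i j
  fin_cases i <;> fin_cases j <;> simp [mul_apply, Fin.sum_univ_two, add_comm]

/-- If `g` is a scalar times a transvection and `F` has more than three elements, then all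
transvections are products of two elements of `conjQuot g`. -/
lemma exists_unip_eq_mul [Fintype F] (h2 : (2 : F) ≠ 0) {g : GL (Fin 2) F} {l b : F}
    (hg : g.val = !![l, l; 0, l]) (hb0 : b ≠ 0) (hb : b ^ 2 - 1 ≠ 0) (f : F) :
    ∃ z ∈ conjQuot g, ∃ w ∈ conjQuot g, unip f = z * w := by
  have hdiag (x : F) (hx : x ≠ 0) : ∃ s : GL (Fin 2) F, s.val = !![x, 0; 0, x⁻¹] ∧
      s.val.det = 1 :=
    ⟨GeneralLinearGroup.mkOfDetNeZero !![x, 0; 0, x⁻¹] (by simp [det_fin_two_of, hx]), rfl,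
      by simp [GeneralLinearGroup.mkOfDetNeZero, det_fin_two_of, hx]⟩
  have hc : unip (b ^ 2 - 1) ∈ conjQuot g := by
    obtain ⟨s, hs, hs1⟩ := hdiag b hb0
    apply mem_of_mul_eq hs1
    rw [hs, unip_val, hg]
    ext i j
    fin_cases i <;> fin_cases j <;> simp [mul_apply, Fin.sum_univ_two]
    · ring
    · field_simp
      ring
    · ring
  have hx (x : F) : unip ((b ^ 2 - 1) * x ^ 2) ∈ conjQuot g := by
    by_cases h0 : x = 0
    · have : unip ((b ^ 2 - 1) * x ^ 2) = 1 := by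
        apply Units.ext
        rw [unip_val, h0, Units.val_one, one_fin_two]
        simp
      rw [this]
      exact one_mem g
    · obtain ⟨s, hs, hs1⟩ := hdiag x h0
      apply mem_of_conj hs1 hc
      rw [hs, unip_val, unip_val]
      ext i j
      fin_cases i <;> fin_cases j <;> simp [mul_apply, Fin.sum_univ_two]
      field_simp
  obtain ⟨x, y, hxy⟩ := exists_quadratic_eq (t := 0) (d := 1) h2
    (by
      rw [show (0 : F) ^ 2 - 4 * 1 = - (2 * 2) by norm_num]
      exact neg_ne_zero.2 (mul_ne_zero h2 h2)) (f / (b ^ 2 - 1))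
  refine ⟨_, hx x, _, hx y, ?_⟩
  rw [unip_mul]
  congr 1
  rw [eq_div_iff hb] at hxy
  linear_combination -hxy

/-- `-1` is a product of three transvections. -/
lemma neg_one_eq : ∃ s r : GL (Fin 2) F, s ∈ SL2sub F ∧ r ∈ SL2sub F ∧
    unip 1 * (s * unip 4 * s⁻¹) * (r * unip 1 * r⁻¹) = -1 := by
  let s : GL (Fin 2) F := GeneralLinearGroup.mkOfDetNeZero !![0, -1; 1, 0]
    (by simp [det_fin_two_of])
  let r : GL (Fin 2) F := GeneralLinearGroup.mkOfDetNeZero !![1, 0; 2, 1]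
    (by simp [det_fin_two_of])
  have hs : s.val = !![0, -1; 1, 0] := rfl
  have hr : r.val = !![1, 0; 2, 1] := rfl
  refine ⟨s, r, (mem_SL2sub_iff s).2 (by simp [hs, det_fin_two_of]),
    (mem_SL2sub_iff r).2 (by simp [hr, det_fin_two_of]), ?_⟩
  apply Units.ext
  simp only [Units.val_mul, coe_units_inv, hs, hr, unip_val, inv_def, adjugate_fin_two_of,
    det_fin_two_of]
  ext i j
  fin_cases i <;> fin_cases j <;> simp [mul_apply, Fin.sum_univ_two] <;> norm_num

/-- Assembling factors from `conjQuot g` into the alternating product. -/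
lemma exists_factors {g T : GL (Fin 2) F} (z : Fin 6 → GL (Fin 2) F)
    (hz : ∀ i, z i ∈ conjQuot g) (hT : z 0 * z 1 * z 2 * z 3 * z 4 * z 5 = T) :
    ∃ x y : Fin 6 → GL (Fin 2) F,
      (∀ i, x i ∈ {c : GL (Fin 2) F | ∃ s ∈ SL2sub F, c = s * g * s⁻¹}) ∧
      (∀ i, y i ∈ {c : GL (Fin 2) F | ∃ s ∈ SL2sub F, c = s * g * s⁻¹}⁻¹) ∧
      x 0 * y 0 * (x 1 * y 1) * (x 2 * y 2) * (x 3 * y 3) * (x 4 * y 4) * (x 5 * y 5) = T := by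
  choose s hs r hr h using hz
  refine ⟨fun i => s i * g * (s i)⁻¹, fun i => (r i * g * (r i)⁻¹)⁻¹, fun i => ⟨s i, hs i, rfl⟩,
    fun i => ⟨r i, hr i, inv_inv _⟩, ?_⟩
  simp only [← h, hT]

lemma odd_case [Fintype F] (h2 : (2 : F) ≠ 0) {g : GL (Fin 2) F}
    (hg : ¬ (g.val 0 1 = 0 ∧ g.val 1 0 = 0 ∧ g.val 0 0 = g.val 1 1)) :
    ∃ z : Fin 6 → GL (Fin 2) F, (∀ i, z i ∈ conjQuot g) ∧
      z 0 * z 1 * z 2 * z 3 * z 4 * z 5 = -1 := by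
  have hd : g.val.det ≠ 0 := ((Matrix.isUnit_iff_isUnit_det _).1 g.isUnit).ne_zero
  have key : (∃ z ∈ conjQuot g, z.val.trace = 0) → ∃ z : Fin 6 → GL (Fin 2) F,
      (∀ i, z i ∈ conjQuot g) ∧ z 0 * z 1 * z 2 * z 3 * z 4 * z 5 = -1 := by
    rintro ⟨z, hz, ht⟩
    refine ⟨![z, z, 1, 1, 1, 1], ?_, ?_⟩
    · intro i
      fin_cases i <;> first | exact hz | exact one_mem g
    · simpa using sq_eq_neg_one (det_of_mem hz) ht
  by_cases hΔ : g.val.trace ^ 2 - 4 * g.val.det = 0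
  swap
  · exact key (exists_trace_eq_zero h2 hg hΔ)
  have hl : g.val.det = (g.val.trace / 2) ^ 2 := by
    have h4 : (4 : F) = 2 * 2 := by norm_num
    rw [h4] at hΔ
    field_simp
    linear_combination -hΔ
  set l := g.val.trace / 2 with hl_def
  have hl0 : l ≠ 0 := by
    rintro h
    simp [hl, h] at hd
  by_cases hb : ∀ b : F, b = 0 ∨ b ^ 2 - 1 = 0
  · have h3 : (3 : F) = 0 := by
      have := (hb 2).resolve_left h2
      linear_combination this
    apply key
    apply exists_trace hg l 0
    rw [hl]
    linear_combination l ^ 2 * h3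
  push Not at hb
  obtain ⟨b, hb0, hb1⟩ := hb
  let k : GL (Fin 2) F := GeneralLinearGroup.mkOfDetNeZero !![l, l; 0, l]
    (by simp [det_fin_two_of, hl0])
  have hk : k.val = !![l, l; 0, l] := rfl
  obtain ⟨P, hP⟩ := exists_conj_of_trace_det_eq (A := k) (B := g)
    (by simp [hk, hl0]) hg
    (by rw [hk, trace_fin_two_of, hl_def]; field_simp; ring)
    (by rw [hk, det_fin_two_of, hl]; ring)
  have hgk : g = P * k * P⁻¹ := eq_mul_inv_of_mul_eq hP
  obtain ⟨z₁, hz₁, w₁, hw₁, h₁⟩ := exists_unip_eq_mul h2 hk hb0 hb1 1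
  obtain ⟨z₄, hz₄, w₄, hw₄, h₄⟩ := exists_unip_eq_mul h2 hk hb0 hb1 4
  obtain ⟨s, r, hs, hr, hsr⟩ := neg_one_eq (F := F)
  refine ⟨fun i => P * (![z₁, w₁, s * z₄ * s⁻¹, s * w₄ * s⁻¹, r * z₁ * r⁻¹, r * w₁ * r⁻¹] i) *
    P⁻¹, ?_, ?_⟩
  · intro i
    rw [hgk]
    apply conj_mem_conj
    fin_cases i
    exacts [hz₁, hw₁, conj_mem hs hz₄, conj_mem hs hw₄, conj_mem hr hz₁, conj_mem hr hw₁]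
  · have : (-1 : GL (Fin 2) F) = P * -1 * P⁻¹ := by simp
    rw [this, ← hsr, h₁, h₄]
    simp only [cons_val]
    group

lemma even_case [Fintype F] (h2 : ringChar F = 2) (hF : 2 < Fintype.card F) {g : GL (Fin 2) F}
    (hg : ¬ (g.val 0 1 = 0 ∧ g.val 1 0 = 0 ∧ g.val 0 0 = g.val 1 1)) :
    ∃ z : Fin 6 → GL (Fin 2) F, (∀ i, z i ∈ conjQuot g) ∧
      z 0 * z 1 * z 2 * z 3 * z 4 * z 5 = unip 1 := by
  classical
  have h20 : (2 : F) = 0 := by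
    have := ringChar.Nat.cast_ringChar (R := F)
    rw [h2] at this
    exact_mod_cast this
  obtain ⟨l, hl⟩ : ∃ l : F, l ∉ ({0, 1} : Finset F) := by
    by_contra! h
    have := Finset.card_le_card (fun x _ => h x : Finset.univ ⊆ ({0, 1} : Finset F))
    have := Finset.card_le_two (a := (0 : F)) (b := 1)
    rw [Finset.card_univ] at *
    omega
  simp only [Finset.mem_insert, Finset.mem_singleton, not_or] at hl
  obtain ⟨hl0, hl1⟩ := hl
  have hll : l ≠ l⁻¹ := by
    intro h
    have h' : l * l = 1 := by nth_rewrite 2 [h]; exact mul_inv_cancel₀ hl0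
    have : (l - 1) ^ 2 = 0 := by linear_combination h' + (1 - l) * h20
    exact hl1 (sub_eq_zero.1 (pow_eq_zero_iff two_ne_zero |>.1 this))
  obtain ⟨a, ha⟩ := FiniteField.isSquare_of_char_two h2 (g.val.det * (l + l⁻¹ - 2))
  obtain ⟨z, hz, hzt⟩ := exists_trace hg a (l + l⁻¹) (by rw [ha]; ring)
  have hzd := det_of_mem hz
  have hzs : ¬ (z.val 0 1 = 0 ∧ z.val 1 0 = 0 ∧ z.val 0 0 = z.val 1 1) := by
    rintro ⟨-, -, h⟩
    rw [trace_fin_two, h] at hzt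
    apply hll
    linear_combination -hzt + (z.val 1 1 - l⁻¹) * h20
  have all (M : GL (Fin 2) F) (hM : M.val 0 0 ≠ M.val 1 1) (ht : M.val.trace = l + l⁻¹)
      (hd : M.val.det = 1) : M ∈ conjQuot g := by
    obtain ⟨P, hP⟩ := exists_conj_of_trace_det_eq (A := z) (B := M) hzs (fun h => hM h.2.2)
      (hzt.trans ht.symm) (hzd.trans hd.symm)
    obtain ⟨e, he⟩ := FiniteField.isSquare_of_char_two h2 P.val.det
    have hP0 : P.val.det ≠ 0 := ((Matrix.isUnit_iff_isUnit_det _).1 P.isUnit).ne_zero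
    have he0 : e ≠ 0 := by
      rintro rfl
      simp [he] at hP0
    have hdet : (e⁻¹ • P.val).det = 1 := by
      rw [det_smul, he, Fintype.card_fin]
      field_simp
    refine mem_of_conj (s := GeneralLinearGroup.mkOfDetNeZero (e⁻¹ • P.val)
      (by rw [hdet]; exact one_ne_zero)) hdet hz ?_
    change M.val * (e⁻¹ • P.val) = (e⁻¹ • P.val) * z.val
    rw [mul_smul_comm, smul_mul_assoc, ← Units.val_mul, hP, Units.val_mul]
  let A : GL (Fin 2) F := GeneralLinearGroup.mkOfDetNeZero !![l⁻¹, 0; 0, l]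
    (by simp [det_fin_two_of, hl0])
  let B : GL (Fin 2) F := GeneralLinearGroup.mkOfDetNeZero !![l, l; 0, l⁻¹]
    (by simp [det_fin_two_of, hl0])
  have hAv : A.val = !![l⁻¹, 0; 0, l] := rfl
  have hBv : B.val = !![l, l; 0, l⁻¹] := rfl
  have hA : A ∈ conjQuot g := all A (by simpa [hAv] using hll.symm)
    (by rw [hAv, trace_fin_two_of, add_comm]) (by simp [hAv, det_fin_two_of, hl0])
  have hB : B ∈ conjQuot g := all B (by simpa [hBv] using hll)
    (by rw [hBv, trace_fin_two_of]) (by simp [hBv, det_fin_two_of, hl0])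
  refine ⟨![A, B, 1, 1, 1, 1], ?_, ?_⟩
  · intro i
    fin_cases i <;> first | exact hA | exact hB | exact one_mem g
  · have : A * B = unip 1 := by
      apply Units.ext
      rw [Units.val_mul, hAv, hBv, unip_val]
      ext i j
      fin_cases i <;> fin_cases j <;> simp [mul_apply, Fin.sum_univ_two, hl0]
    simpa using this

end ConjQuot

theorem stmt_10 {F : Type*} [Field F] [Fintype F] {q : ℕ} (hq : Fintype.card F = q)
    (hq2 : 2 < q) (g : GL (Fin 2) F) (hg : g ∉ Subgroup.center (GL (Fin 2) F)) :
    ∃ x y : Fin 6 → GL (Fin 2) F,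
      (∀ i, x i ∈ {c : GL (Fin 2) F | ∃ s ∈ SL2sub F, c = s * g * s⁻¹}) ∧
      (∀ i, y i ∈ {c : GL (Fin 2) F | ∃ s ∈ SL2sub F, c = s * g * s⁻¹}⁻¹) ∧
      (Odd q →
        x 0 * y 0 * (x 1 * y 1) * (x 2 * y 2) * (x 3 * y 3) * (x 4 * y 4) * (x 5 * y 5) = -1) ∧
      (Even q →
        ((x 0 * y 0 * (x 1 * y 1) * (x 2 * y 2) * (x 3 * y 3) * (x 4 * y 4) * (x 5 * y 5) :
          GL (Fin 2) F) : Matrix (Fin 2) (Fin 2) F) = !![1, 1; 0, 1]) := by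
  have hs := ConjQuot.not_scalar hg
  by_cases h2 : ringChar F = 2
  · have hev : Even q := by
      rw [← hq, Nat.even_iff]
      exact FiniteField.even_card_of_char_two h2
    obtain ⟨z, hz, hT⟩ := ConjQuot.even_case h2 (hq ▸ hq2) hs
    obtain ⟨x, y, hx, hy, hxy⟩ := ConjQuot.exists_factors z hz hT
    exact ⟨x, y, hx, hy, fun ho => absurd hev (Nat.not_even_iff_odd.2 ho),
      fun _ => by rw [hxy, ConjQuot.unip_val]⟩
  · have hodd : Odd q := by
      rw [← hq, Nat.odd_iff]
      exact FiniteField.odd_card_of_char_ne_two h2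
    obtain ⟨z, hz, hT⟩ := ConjQuot.odd_case (Ring.two_ne_zero h2) hs
    obtain ⟨x, y, hx, hy, hxy⟩ := ConjQuot.exists_factors z hz hT
    exact ⟨x, y, hx, hy, fun _ => hxy, fun he => absurd he (Nat.not_even_iff_odd.2 hodd)⟩
end

section
/- Let F be a finite field with |F| = q, let n ≥ 2 with (n,q) ≠ (2,2) and (n,q) ≠ (2,3), let G = GL_n(F), S = SL_n(F), let g ∈ G \ Z(G) and set C = g^S. Then there exist k ≤ 48, elements x₁,…,x_k ∈ C and y₁,…,y_k ∈ C⁻¹, such that the element t = x₁y₁x₂y₂⋯x_k y_k satisfies t ∉ Z(G) and t² ∈ {I_n, −I_n}. -/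
/-- The subgroup `SL_n(F)` of `GL_n(F)`, as the range of the natural embedding. -/
def SLsub (n : ℕ) (F : Type*) [Field F] : Subgroup (GL (Fin n) F) :=
  (Matrix.SpecialLinearGroup.toGL (n := Fin n) (R := F)).range

section

open Matrix Pointwise

/-- The set `C * C⁻¹`, where `C` is the `SL_n(F)`-conjugacy class of `g`. -/
def classQuotient {n : ℕ} {F : Type*} [Field F] (g : GL (Fin n) F) : Set (GL (Fin n) F) :=
  {c : GL (Fin n) F | ∃ s ∈ SLsub n F, c = s * g * s⁻¹} *
    {c : GL (Fin n) F | ∃ s ∈ SLsub n F, c = s * g * s⁻¹}⁻¹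

variable {F : Type*} [Field F] {n : ℕ}

theorem mem_SLsub_iff {s : GL (Fin n) F} : s ∈ SLsub n F ↔ (s : Matrix (Fin n) (Fin n) F).det = 1 := by
  constructor
  · rintro ⟨t, rfl⟩
    exact t.2
  · intro h
    exact ⟨⟨s, h⟩, Units.ext rfl⟩

theorem conj_mem_SLsub {s : GL (Fin n) F} (C : GL (Fin n) F) (hs : s ∈ SLsub n F) :
    C * s * C⁻¹ ∈ SLsub n F := by
  rw [mem_SLsub_iff] at hs ⊢
  rw [Units.val_mul, Units.val_mul, det_mul_right_comm, Units.mul_inv, one_mul, hs]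

theorem commutator_mem_classQuotient (g : GL (Fin n) F) {u : GL (Fin n) F} (hu : u ∈ SLsub n F) :
    g * u * g⁻¹ * u⁻¹ ∈ classQuotient g := by
  rw [show g * u * g⁻¹ * u⁻¹ = g * (u * g * u⁻¹)⁻¹ by group]
  exact Set.mul_mem_mul ⟨1, one_mem _, by simp⟩ (Set.inv_mem_inv.2 ⟨u, hu, rfl⟩)

theorem inv_mem_classQuotient_pow {g h : GL (Fin n) F} {m : ℕ} (hh : h ∈ classQuotient g ^ m) :
    h⁻¹ ∈ classQuotient g ^ m := by
  have key : (classQuotient g)⁻¹ = classQuotient g := by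
    rw [classQuotient, _root_.mul_inv_rev, inv_inv]
  rw [← key, inv_pow]
  exact Set.inv_mem_inv.2 hh

theorem mul_mem_classQuotient_pow {g h k : GL (Fin n) F} {m l : ℕ}
    (hh : h ∈ classQuotient g ^ m) (hk : k ∈ classQuotient g ^ l) :
    h * k ∈ classQuotient g ^ (m + l) := by
  rw [pow_add]
  exact Set.mul_mem_mul hh hk

theorem image_pow_subset {G : Type*} [Group G] (f : G →* G) {A B : Set G}
    (hAB : Set.MapsTo f A B) {m : ℕ} {h : G} (hh : h ∈ A ^ m) : f h ∈ B ^ m := by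
  have : f h ∈ (f '' A) ^ m := by
    rw [← Set.image_pow]
    exact ⟨h, hh, rfl⟩
  exact Set.pow_subset_pow_left hAB.image_subset this

theorem conj_mem_classQuotient_pow {g h s : GL (Fin n) F} (hs : s ∈ SLsub n F) {m : ℕ}
    (hh : h ∈ classQuotient g ^ m) : s * h * s⁻¹ ∈ classQuotient g ^ m := by
  refine image_pow_subset (MulAut.conj s).toMonoidHom (A := classQuotient g) ?_ hh
  rintro _ ⟨x, ⟨a, ha, rfl⟩, y, ⟨b, hb, hy⟩, rfl⟩
  refine ⟨s * (a * g * a⁻¹) * s⁻¹, ⟨s * a, mul_mem hs ha, by group⟩, s * y * s⁻¹,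
    ⟨s * b, mul_mem hs hb, ?_⟩, ?_⟩
  · rw [show (s * y * s⁻¹)⁻¹ = s * y⁻¹ * s⁻¹ by group, hy]; group
  · simp [mul_assoc]

theorem conj_mem_classQuotient_conj_pow {g h : GL (Fin n) F} (C : GL (Fin n) F) {m : ℕ}
    (hh : h ∈ classQuotient g ^ m) :
    C * h * C⁻¹ ∈ classQuotient (C * g * C⁻¹) ^ m := by
  refine image_pow_subset (MulAut.conj C).toMonoidHom (A := classQuotient g) ?_ hh
  rintro _ ⟨x, ⟨a, ha, rfl⟩, y, ⟨b, hb, hy⟩, rfl⟩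
  refine ⟨C * (a * g * a⁻¹) * C⁻¹, ⟨C * a * C⁻¹, conj_mem_SLsub C ha, by group⟩, C * y * C⁻¹,
    ⟨C * b * C⁻¹, conj_mem_SLsub C hb, ?_⟩, ?_⟩
  · rw [show (C * y * C⁻¹)⁻¹ = C * y⁻¹ * C⁻¹ by group, hy]; group
  · simp [mul_assoc]

theorem commutator_mem_classQuotient_pow {g h s : GL (Fin n) F} (hs : s ∈ SLsub n F) {m : ℕ}
    (hh : h ∈ classQuotient g ^ m) : h * s * h⁻¹ * s⁻¹ ∈ classQuotient g ^ (m + m) := by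
  rw [show h * s * h⁻¹ * s⁻¹ = h * (s * h⁻¹ * s⁻¹) by group]
  exact mul_mem_classQuotient_pow hh (conj_mem_classQuotient_pow hs (inv_mem_classQuotient_pow hh))

theorem vecMulVec_mul_self {c δ : Fin n → F} (h : δ ⬝ᵥ c = 0) :
    vecMulVec c δ * vecMulVec c δ = 0 := by
  rw [vecMulVec_mul_vecMulVec, h, zero_smul, vecMulVec_zero]

/-- The transvection `x ↦ x + (δ ⬝ᵥ x) • c`, where `δ ⬝ᵥ c = 0`. -/
def vecTransvection (c δ : Fin n → F) (h : δ ⬝ᵥ c = 0) : GL (Fin n) F where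
  val := 1 + vecMulVec c δ
  inv := 1 - vecMulVec c δ
  val_inv := by simp [add_mul, mul_sub, vecMulVec_mul_self h]
  inv_val := by simp [sub_mul, mul_add, vecMulVec_mul_self h]

@[simp] theorem vecTransvection_val (c δ : Fin n → F) (h : δ ⬝ᵥ c = 0) :
    (vecTransvection c δ h : Matrix (Fin n) (Fin n) F) = 1 + vecMulVec c δ := rfl

theorem vecTransvection_inv_val (c δ : Fin n → F) (h : δ ⬝ᵥ c = 0) :
    ((vecTransvection c δ h)⁻¹ : GL (Fin n) F).val = 1 - vecMulVec c δ := rfl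

theorem vecTransvection_mem_SLsub (c δ : Fin n → F) (h : δ ⬝ᵥ c = 0) :
    vecTransvection c δ h ∈ SLsub n F := by
  rw [mem_SLsub_iff, vecTransvection_val, vecMulVec_eq Unit,
    det_one_add_replicateCol_mul_replicateRow, h, add_zero]

theorem exists_dual_vectors {c δ : Fin n → F} (hc : c ≠ 0) (hδ : δ ≠ 0) (h : δ ⬝ᵥ c = 0) :
    ∃ e ε : Fin n → F, δ ⬝ᵥ e = 1 ∧ ε ⬝ᵥ e = 0 ∧ ε ⬝ᵥ c = -1 := by
  obtain ⟨j, hj⟩ := Function.ne_iff.1 hδ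
  obtain ⟨i, hi⟩ := Function.ne_iff.1 hc
  rw [Pi.zero_apply] at hi hj
  have he : δ ⬝ᵥ Pi.single j (δ j)⁻¹ = 1 := by simp [hj]
  have hε : Pi.single i (-(c i)⁻¹) ⬝ᵥ c = -1 := by simp [hi]
  refine ⟨Pi.single j (δ j)⁻¹,
    Pi.single i (-(c i)⁻¹) - (Pi.single i (-(c i)⁻¹) ⬝ᵥ Pi.single j (δ j)⁻¹) • δ, he, ?_, ?_⟩
  · rw [sub_dotProduct, smul_dotProduct, he, smul_eq_mul, mul_one, sub_self]
  · rw [sub_dotProduct, smul_dotProduct, h, hε, smul_zero, sub_zero]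

/-- Relations `N² = M² = 0`, `NMN = -N`, `MNM = -M` give the braid relation. -/
theorem braid_relation {R : Type*} [Ring R] {N M : R} (hN : N * N = 0) (hM : M * M = 0)
    (hNM : N * M * N = -N) (hMN : M * N * M = -M) :
    (1 + N) * (1 + M) * (1 + N) = (1 + M) * (1 + N) * (1 + M) := by
  simp only [mul_add, add_mul, mul_one, one_mul, hN, hM, hNM, hMN]
  abel

theorem braid_sq {R : Type*} [Ring R] {N M : R} (hN : N * N = 0) (hM : M * M = 0)
    (hNM : N * M * N = -N) (hMN : M * N * M = -M) :
    ((1 + N) * (1 + M) * (1 + N)) ^ 2 = 1 + 2 * (N * M + M * N) := by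
  have hw : (1 + N) * (1 + M) * (1 + N) = 1 + (N + M) + (N * M + M * N) := by
    simp only [mul_add, add_mul, mul_one, one_mul, hN, hNM]
    abel
  have hJ : (N + M) * (N + M) = N * M + M * N := by
    simp only [mul_add, add_mul, hN, hM]
    abel
  have hJP : (N + M) * (N * M + M * N) = -(N + M) := by
    simp only [mul_add, add_mul, ← mul_assoc, hN, hM, hNM, hMN]
    simp only [zero_mul]
    abel
  have hPJ : (N * M + M * N) * (N + M) = -(N + M) := by
    simp only [mul_add, add_mul, hNM, hMN]
    simp only [mul_assoc, hN, hM, mul_zero]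
    abel
  have hPP : (N * M + M * N) * (N * M + M * N) = -(N * M + M * N) := by
    rw [← hJ, ← mul_assoc, mul_assoc (N + M), hJ, hJP, neg_mul, hJ]
  generalize N + M = J at *
  generalize N * M + M * N = P at *
  rw [hw, sq]
  simp only [mul_add, add_mul, mul_one, one_mul, hJ, hJP, hPJ, hPP, two_mul]
  abel

theorem braid_pow_four {R : Type*} [Ring R] {N M : R} (hN : N * N = 0) (hM : M * M = 0)
    (hNM : N * M * N = -N) (hMN : M * N * M = -M) :
    (((1 + N) * (1 + M) * (1 + N)) ^ 2) ^ 2 = 1 := by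
  have hPP : (N * M + M * N) * (N * M + M * N) = -(N * M + M * N) := by
    simp only [mul_add, add_mul, ← mul_assoc, hNM, hMN]
    simp only [mul_assoc _ N N, mul_assoc _ M M, hN, hM, mul_zero, zero_mul, neg_mul]
    abel
  rw [braid_sq hN hM hNM hMN]
  generalize N * M + M * N = P at *
  rw [sq]
  simp only [mul_add, add_mul, mul_one, one_mul, two_mul, hPP]
  abel

/-- A power of `C * C⁻¹` that contains a nontrivial transvection `1 + N` yields a noncentral
element squaring to `±1`: the Weyl element `w` built from `1 + N` and an opposite transvection,
or its square. -/
theorem exists_sq_eq_of_vecTransvection_mem {g : GL (Fin n) F} {m : ℕ} {c δ : Fin n → F}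
    (hc : c ≠ 0) (hδ : δ ≠ 0) (h : δ ⬝ᵥ c = 0)
    (hT : vecTransvection c δ h ∈ classQuotient g ^ m) :
    ∃ k ≤ 6 * m, ∃ t ∈ classQuotient g ^ k, t ∉ Subgroup.center (GL (Fin n) F) ∧
      (t ^ 2 = 1 ∨ t ^ 2 = -1) := by
  obtain ⟨e, ε, he, hε, hεc⟩ := exists_dual_vectors hc hδ h
  have hN := vecMulVec_mul_self h
  have hM := vecMulVec_mul_self hε
  have hNM : vecMulVec c δ * vecMulVec e ε * vecMulVec c δ = -vecMulVec c δ := by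
    simp [vecMulVec_mul_vecMulVec, he, hεc, vecMulVec_neg]
  have hMN : vecMulVec e ε * vecMulVec c δ * vecMulVec e ε = -vecMulVec e ε := by
    simp [vecMulVec_mul_vecMulVec, he, hεc, vecMulVec_neg]
  have hN0 : vecMulVec c δ ≠ 0 := vecMulVec_ne_zero hc hδ
  set T := vecTransvection c δ h with hTdef
  set T' := vecTransvection e ε hε with hT'def
  set w := T * T' * T with hw
  have hwS : w ∈ SLsub n F :=
    mul_mem (mul_mem (vecTransvection_mem_SLsub _ _ _) (vecTransvection_mem_SLsub _ _ _))
      (vecTransvection_mem_SLsub _ _ _)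
  have hbraid : w = T' * T * T' := Units.ext (braid_relation hN hM hNM hMN)
  have hconj : w⁻¹ * T * w = T' := by
    rw [mul_assoc, inv_mul_eq_iff_eq_mul]
    nth_rw 1 [hbraid]
    rw [hw]
    group
  have hT' : T' ∈ classQuotient g ^ m := by
    simpa [hconj] using conj_mem_classQuotient_pow (inv_mem hwS) hT
  have hwmem : w ∈ classQuotient g ^ (m + m + m) :=
    mul_mem_classQuotient_pow (mul_mem_classQuotient_pow hT hT') hT
  have hsq : (w ^ 2 : GL (Fin n) F).val = 1 + 2 * (vecMulVec c δ * vecMulVec e ε +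
      vecMulVec e ε * vecMulVec c δ) := braid_sq hN hM hNM hMN
  by_cases hneg : w ^ 2 = -1
  · refine ⟨m + m + m, by omega, w, hwmem, fun hcen => ?_, .inr hneg⟩
    rw [mul_assoc, Subgroup.mem_center_iff.1 hcen T, inv_mul_cancel_left] at hconj
    have hval := congrArg Units.val hconj
    rw [hTdef, hT'def, vecTransvection_val, vecTransvection_val, add_right_inj] at hval
    rw [← hval, hN, zero_mul, zero_eq_neg] at hNM
    exact hN0 hNM
  · refine ⟨m + m + m + (m + m + m), by omega, w ^ 2, ?_, fun hcen => hneg ?_,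
      .inl (Units.ext ?_)⟩
    · rw [sq]
      exact mul_mem_classQuotient_pow hwmem hwmem
    · obtain ⟨a, ha⟩ := GeneralLinearGroup.mem_center_iff_val_mem_range_scalar.1 hcen
      have hmul : (w ^ 2 : GL (Fin n) F).val * vecMulVec c δ = -vecMulVec c δ := by
        rw [hsq, add_mul, one_mul, mul_assoc, add_mul, hNM, mul_assoc, hN, mul_zero, add_zero,
          two_mul]
        abel
      have ha1 : a = -1 := by
        rw [← ha, scalar_apply, ← smul_eq_diagonal_mul, ← neg_one_smul F] at hmul
        exact smul_left_injective F hN0 hmul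
      ext1
      rw [← ha, ha1, map_neg, map_one]
      rfl
    · have hwval : w.val = (1 + vecMulVec c δ) * (1 + vecMulVec e ε) * (1 + vecMulVec c δ) := rfl
      rw [Units.val_pow_eq_pow_val, Units.val_pow_eq_pow_val, hwval]
      exact braid_pow_four hN hM hNM hMN

theorem exists_vecTransvection_not_commute {g : GL (Fin n) F}
    (hg : g ∉ Subgroup.center (GL (Fin n) F)) :
    ∃ (c δ : Fin n → F) (h : δ ⬝ᵥ c = 0),
      g * vecTransvection c δ h ≠ vecTransvection c δ h * g := by
  contrapose! hg
  rw [GeneralLinearGroup.mem_center_iff_val_mem_range_scalar]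
  refine mem_range_scalar_of_commute_transvectionStruct fun t => ?_
  have h := hg (Pi.single t.i t.c) (Pi.single t.j 1) (by simp [t.hij])
  have hval := congrArg Units.val h
  have hsingle : vecMulVec (Pi.single t.i t.c) (Pi.single t.j 1) = single t.i t.j t.c := by
    ext i j
    simp only [vecMulVec_apply, single_apply, Pi.single_apply, eq_comm (a := t.i),
      eq_comm (a := t.j), ite_and]
    split_ifs <;> simp
  rw [Units.val_mul, Units.val_mul, vecTransvection_val, hsingle] at hval
  exact hval.symm

theorem exists_ne_zero_dotProduct_eq_zero_pair (hn : 3 ≤ n) (φ ψ : Fin n → F) :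
    ∃ c : Fin n → F, c ≠ 0 ∧ φ ⬝ᵥ c = 0 ∧ ψ ⬝ᵥ c = 0 := by
  have hker : LinearMap.ker (mulVecLin (of ![φ, ψ])) ≠ ⊥ :=
    LinearMap.ker_ne_bot_of_finrank_lt (by simp; omega)
  obtain ⟨c, hc, hc0⟩ := Submodule.exists_mem_ne_zero_of_ne_bot hker
  have h : of ![φ, ψ] *ᵥ c = 0 := hc
  exact ⟨c, hc0, congrFun h 0, congrFun h 1⟩

/-- The commutator of `h` with a transvection along a vector fixed by `h` is a transvection. -/
theorem commutator_vecTransvection_of_fixed {h : GL (Fin n) F} {c γ : Fin n → F}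
    (hc : h.val *ᵥ c = c) (hγ : γ ⬝ᵥ c = 0) :
    ∃ hδ : (γ ᵥ* h⁻¹.val - γ) ⬝ᵥ c = 0,
      h * vecTransvection c γ hγ * h⁻¹ * (vecTransvection c γ hγ)⁻¹ =
        vecTransvection c (γ ᵥ* h⁻¹.val - γ) hδ := by
  have hc' : h⁻¹.val *ᵥ c = c := by
    conv_lhs => rw [← hc]
    rw [mulVec_mulVec, Units.inv_mul, one_mulVec]
  have hγ' : γ ᵥ* h⁻¹.val ⬝ᵥ c = 0 := by rw [← dotProduct_mulVec, hc', hγ]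
  refine ⟨by rw [sub_dotProduct, hγ', hγ, sub_zero], Units.ext ?_⟩
  rw [Units.val_mul, Units.val_mul, Units.val_mul, vecTransvection_inv_val, vecTransvection_val,
    vecTransvection_val, mul_add, mul_one, add_mul, Units.mul_inv, mul_vecMulVec, hc,
    vecMulVec_mul, add_mul, one_mul, mul_sub, mul_one, vecMulVec_mul_vecMulVec, hγ', zero_smul,
    vecMulVec_zero, vecMulVec_sub]
  abel

/-- If every covector vanishing on a nonzero fixed vector `c` of `h` is fixed by `h`, then `h` is a
transvection along `c`. -/
theorem exists_eq_vecTransvection {h : GL (Fin n) F} {c : Fin n → F} (hc0 : c ≠ 0)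
    (hc : h.val *ᵥ c = c) (hfix : ∀ γ : Fin n → F, γ ⬝ᵥ c = 0 → γ ᵥ* h.val = γ) :
    ∃ (δ : Fin n → F) (hδ : δ ⬝ᵥ c = 0), h = vecTransvection c δ hδ := by
  obtain ⟨i, hi⟩ := Function.ne_iff.1 hc0
  rw [Pi.zero_apply] at hi
  have hM : (h.val - 1) *ᵥ c = 0 := by rw [sub_mulVec, hc, one_mulVec, sub_self]
  refine ⟨(c i)⁻¹ • (h.val - 1).row i, ?_, Units.ext ?_⟩
  · rw [smul_dotProduct, show (h.val - 1).row i ⬝ᵥ c = 0 from congrFun hM i, smul_zero]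
  · rw [vecTransvection_val, ← sub_eq_iff_eq_add']
    ext j k
    have hj := hfix (Pi.single j (c i) - Pi.single i (c j)) (by simp [mul_comm])
    have hjk : ((Pi.single j (c i) - Pi.single i (c j)) ᵥ* (h.val - 1)) k = 0 := by
      rw [vecMul_sub, hj, vecMul_one, sub_self, Pi.zero_apply]
    simp only [sub_vecMul, single_vecMul, Pi.sub_apply, Pi.smul_apply, row_apply,
      smul_eq_mul] at hjk
    rw [vecMulVec_apply, Pi.smul_apply, row_apply, smul_eq_mul]
    field_simp
    linear_combination hjk

theorem exists_vecTransvection_mem_of_fixed {g h : GL (Fin n) F} {m : ℕ}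
    (hh : h ∈ classQuotient g ^ m) (h1 : h ≠ 1) {c : Fin n → F} (hc0 : c ≠ 0)
    (hc : h.val *ᵥ c = c) :
    ∃ k ≤ 2 * m, ∃ (c δ : Fin n → F) (hδ : δ ⬝ᵥ c = 0), c ≠ 0 ∧ δ ≠ 0 ∧
      vecTransvection c δ hδ ∈ classQuotient g ^ k := by
  by_cases hfix : ∀ γ : Fin n → F, γ ⬝ᵥ c = 0 → γ ᵥ* h.val = γ
  · obtain ⟨δ, hδ, rfl⟩ := exists_eq_vecTransvection hc0 hc hfix
    refine ⟨m, by omega, c, δ, hδ, hc0, ?_, hh⟩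
    rintro rfl
    exact h1 (Units.ext (by simp))
  · push Not at hfix
    obtain ⟨γ, hγ, hne⟩ := hfix
    obtain ⟨hδ, heq⟩ := commutator_vecTransvection_of_fixed hc hγ
    refine ⟨m + m, by omega, c, _, hδ, hc0, fun h0 => hne ?_, heq ▸
      commutator_mem_classQuotient_pow (vecTransvection_mem_SLsub c γ hγ) hh⟩
    conv_lhs => rw [← sub_eq_zero.1 h0]
    rw [vecMul_vecMul, Units.inv_mul, vecMul_one]

theorem exists_vecTransvection_mem_of_three_le (hn : 3 ≤ n) {g : GL (Fin n) F}
    (hg : g ∉ Subgroup.center (GL (Fin n) F)) :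
    ∃ k ≤ 2, ∃ (c δ : Fin n → F) (hδ : δ ⬝ᵥ c = 0), c ≠ 0 ∧ δ ≠ 0 ∧
      vecTransvection c δ hδ ∈ classQuotient g ^ k := by
  obtain ⟨v, φ, hφ, hne⟩ := exists_vecTransvection_not_commute hg
  obtain ⟨c, hc0, hc1, hc2⟩ := exists_ne_zero_dotProduct_eq_zero_pair hn φ (φ ᵥ* g⁻¹.val)
  have hmem := commutator_mem_classQuotient g (vecTransvection_mem_SLsub v φ hφ)
  refine exists_vecTransvection_mem_of_fixed (m := 1) (by rwa [pow_one]) (fun h1 => hne ?_) hc0 ?_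
  · rwa [mul_inv_eq_one, mul_inv_eq_iff_eq_mul] at h1
  · rw [Units.val_mul, Units.val_mul, Units.val_mul, vecTransvection_inv_val, vecTransvection_val,
      ← mulVec_mulVec, sub_mulVec, one_mulVec, vecMulVec_mulVec, hc1, ← mulVec_mulVec,
      ← mulVec_mulVec, add_mulVec, vecMulVec_mulVec, MulOpposite.op_zero, zero_smul, sub_zero,
      dotProduct_mulVec, hc2, MulOpposite.op_zero, zero_smul, add_zero, one_mulVec, mulVec_mulVec,
      Units.mul_inv, one_mulVec]

/-- A noncentral `2 × 2` matrix is conjugate to a companion matrix. -/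
theorem exists_conj_companion {g : GL (Fin 2) F} (hg : g ∉ Subgroup.center (GL (Fin 2) F)) :
    ∃ (C K : GL (Fin 2) F) (d t : F), d ≠ 0 ∧ g = C * K * C⁻¹ ∧ K.val = !![0, -d; 1, t] := by
  obtain ⟨v, hv⟩ : ∃ v : Fin 2 → F, (!![v 0, (g.val *ᵥ v) 0; v 1, (g.val *ᵥ v) 1]).det ≠ 0 := by
    contrapose! hg
    have h1 := hg ![1, 0]
    have h2 := hg ![0, 1]
    have h3 := hg ![1, 1]
    simp [det_fin_two, mulVec, dotProduct, Fin.sum_univ_two] at h1 h2 h3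
    rw [GeneralLinearGroup.mem_center_iff_val_mem_range_scalar]
    refine ⟨g.val 0 0, ?_⟩
    ext i j
    fin_cases i <;> fin_cases j <;> simp <;> grind
  let C := GeneralLinearGroup.mkOfDetNeZero _ hv
  refine ⟨C, C⁻¹ * g * C, g.val.det, g.val.trace, GeneralLinearGroup.det_ne_zero g, by group, ?_⟩
  have hval : C.val * (C⁻¹ * g * C).val = C.val * !![0, -g.val.det; 1, g.val.trace] := by
    rw [← Units.val_mul, show C * (C⁻¹ * g * C) = g * C by group, Units.val_mul]
    ext i j
    fin_cases i <;> fin_cases j <;>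
      simp [C, GeneralLinearGroup.mkOfDetNeZero, det_fin_two, trace_fin_two, mulVec, dotProduct,
        mul_apply, Fin.sum_univ_two] <;> ring
  exact C.isUnit.mul_left_cancel hval

theorem exists_ne_zero_mul_sq_ne_one [Fintype F] (hq : 4 ≤ Fintype.card F) (d : F) :
    ∃ y : F, y ≠ 0 ∧ d * y ^ 2 ≠ 1 := by
  classical
  by_contra! h
  have hd : d = 1 := by simpa using h 1 one_ne_zero
  have hsub : (Finset.univ : Finset F) ⊆ {0, 1, -1} := fun y _ => by
    by_cases hy : y = 0
    · simp [hy]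
    · have := h y hy
      rw [hd, one_mul, sq_eq_one_iff] at this
      simpa [hy] using this
  have := (Finset.card_le_card hsub).trans Finset.card_le_three
  rw [Finset.card_univ] at this
  omega

/-- For a companion matrix `K` of determinant `d`, the commutator of `K` with a suitable elementary
matrix has eigenvalue `d * y ^ 2` on the vector `(1, -y)`. -/
theorem exists_vecTransvection_mem_of_companion {K : GL (Fin 2) F} {d t y : F} (hd : d ≠ 0)
    (hK : K.val = !![0, -d; 1, t]) (hy : y ≠ 0) (hdy : d * y ^ 2 ≠ 1) :
    ∃ (c δ : Fin 2 → F) (hδ : δ ⬝ᵥ c = 0), c ≠ 0 ∧ δ ≠ 0 ∧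
      vecTransvection c δ hδ ∈ classQuotient K ^ 2 := by
  obtain ⟨z, hz⟩ : ∃ z, z * y = d * y ^ 2 - 1 := ⟨(d * y ^ 2 - 1) / y, by field_simp⟩
  let u : GL (Fin 2) F := vecTransvection ![z, 0] ![0, 1] (by simp)
  have hu : u.val = !![1, z; 0, 1] := by
    ext i j
    fin_cases i <;> fin_cases j <;> simp [u]
  obtain ⟨h, hdef⟩ : ∃ h, h = K * u * K⁻¹ * u⁻¹ := ⟨_, rfl⟩
  have hmem : h ∈ classQuotient K ^ 1 := by
    rw [pow_one, hdef]
    exact commutator_mem_classQuotient K (vecTransvection_mem_SLsub _ _ _)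
  have hh : h.val = !![1, -z; -z / d, 1 + z ^ 2 / d] := by
    have hmul : h.val * (u * K).val = !![1, -z; -z / d, 1 + z ^ 2 / d] * (u * K).val := by
      rw [← Units.val_mul, show h * (u * K) = K * u by rw [hdef]; group, Units.val_mul,
        Units.val_mul, hu, hK]
      ext i j
      fin_cases i <;> fin_cases j <;> simp [mul_apply, Fin.sum_univ_two] <;> field_simp <;> ring
    exact (u * K).isUnit.mul_right_cancel hmul
  have hγ : ![y, 1] ⬝ᵥ ![1, -y] = 0 := by simp
  have hc0 : ![1, -y] ≠ 0 := fun h0 => one_ne_zero (congrFun h0 0)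
  by_cases hsq : (d * y ^ 2) ^ 2 = 1
  · have hneg : d * y ^ 2 = -1 := (sq_eq_one_iff.1 hsq).resolve_left hdy
    have h2 : (2 : F) ≠ 0 := fun h2 => hdy (by linear_combination hneg - h2)
    have hδ : (-4 / y) • ![y, 1] ⬝ᵥ ![1, -y] = 0 := by rw [smul_dotProduct, hγ, smul_zero]
    refine ⟨![1, -y], (-4 / y) • ![y, 1], hδ, hc0, fun h0 => ?_, ?_⟩
    · have := congrFun h0 0
      simp [hy] at this
      exact h2 (pow_eq_zero_iff two_ne_zero |>.1 (by linear_combination this))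
    · have heq : vecTransvection ![1, -y] ((-4 / y) • ![y, 1]) hδ = h * h := by
        ext1
        rw [Units.val_mul, hh]
        ext i j
        fin_cases i <;> fin_cases j <;>
          simp [mul_apply, Fin.sum_univ_two] <;> field_simp <;> grind
      rw [heq]
      exact mul_mem_classQuotient_pow hmem hmem
  · let s : GL (Fin 2) F := vecTransvection ![1, -y] ![y, 1] hγ
    have hδ : ((d * y ^ 2) ^ 2 - 1) • ![y, 1] ⬝ᵥ ![1, -y] = 0 := by
      rw [smul_dotProduct, hγ, smul_zero]
    refine ⟨![1, -y], ((d * y ^ 2) ^ 2 - 1) • ![y, 1], hδ, hc0, fun h0 => hsq ?_, ?_⟩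
    · have := congrFun h0 1
      simpa [sub_eq_zero] using this
    · have heq : vecTransvection ![1, -y] (((d * y ^ 2) ^ 2 - 1) • ![y, 1]) hδ =
          h * s * h⁻¹ * s⁻¹ := by
        rw [eq_mul_inv_iff_mul_eq, eq_mul_inv_iff_mul_eq]
        ext1
        rw [Units.val_mul, Units.val_mul, Units.val_mul, hh]
        ext i j
        fin_cases i <;> fin_cases j <;>
          simp [s, mul_apply, Fin.sum_univ_two] <;> field_simp <;> grind
      rw [heq]
      exact commutator_mem_classQuotient_pow (vecTransvection_mem_SLsub _ _ _) hmem

theorem exists_sq_eq_of_two [Fintype F] (hq : 4 ≤ Fintype.card F) {g : GL (Fin 2) F}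
    (hg : g ∉ Subgroup.center (GL (Fin 2) F)) :
    ∃ k ≤ 12, ∃ t ∈ classQuotient g ^ k, t ∉ Subgroup.center (GL (Fin 2) F) ∧
      (t ^ 2 = 1 ∨ t ^ 2 = -1) := by
  obtain ⟨C, K, d, t, hd, hC, hK⟩ := exists_conj_companion hg
  obtain ⟨y, hy, hdy⟩ := exists_ne_zero_mul_sq_ne_one hq d
  obtain ⟨c, δ, hδ, hc0, hδ0, hT⟩ := exists_vecTransvection_mem_of_companion hd hK hy hdy
  obtain ⟨k, hk, t, ht, hcen, hsq⟩ := exists_sq_eq_of_vecTransvection_mem hc0 hδ0 hδ hT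
  refine ⟨k, hk, C * t * C⁻¹, hC ▸ conj_mem_classQuotient_conj_pow C ht, fun h => hcen ?_, ?_⟩
  · have := Subgroup.Normal.conj_mem inferInstance _ h C⁻¹
    simpa [mul_assoc] using this
  · rw [conj_pow]
    refine hsq.imp (fun h => by simp [h]) (fun h => by simp [h])

theorem exists_ofFn_prod_of_mem_classQuotient_pow {g t : GL (Fin n) F} {k : ℕ}
    (ht : t ∈ classQuotient g ^ k) :
    ∃ x y : Fin k → GL (Fin n) F,
      (∀ i, x i ∈ {c : GL (Fin n) F | ∃ s ∈ SLsub n F, c = s * g * s⁻¹}) ∧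
      (∀ i, y i ∈ {c : GL (Fin n) F | ∃ s ∈ SLsub n F, c = s * g * s⁻¹}⁻¹) ∧
      (List.ofFn fun i => x i * y i).prod = t := by
  obtain ⟨f, hf⟩ := Set.mem_pow.1 ht
  choose x hx y hy hxy using fun i => Set.mem_mul.1 (f i).2
  exact ⟨x, y, hx, hy, by simpa only [hxy] using hf⟩

theorem exists_sq_eq_of_notMem_center [Fintype F] (hn : 2 ≤ n)
    (hq : n = 2 → 4 ≤ Fintype.card F) {g : GL (Fin n) F}
    (hg : g ∉ Subgroup.center (GL (Fin n) F)) :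
    ∃ k ≤ 12, ∃ t ∈ classQuotient g ^ k, t ∉ Subgroup.center (GL (Fin n) F) ∧
      (t ^ 2 = 1 ∨ t ^ 2 = -1) := by
  obtain rfl | hn3 := hn.eq_or_lt
  · exact exists_sq_eq_of_two (hq rfl) hg
  · obtain ⟨m, hm, c, δ, hδ, hc0, hδ0, hT⟩ := exists_vecTransvection_mem_of_three_le hn3 hg
    obtain ⟨k, hk, ht⟩ := exists_sq_eq_of_vecTransvection_mem hc0 hδ0 hδ hT
    exact ⟨k, by omega, ht⟩

end

theorem stmt_12 {F : Type*} [Field F] [Fintype F] {q n : ℕ} (hq : Fintype.card F = q)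
    (hn : 2 ≤ n) (h22 : ¬(n = 2 ∧ q = 2)) (h23 : ¬(n = 2 ∧ q = 3))
    (g : GL (Fin n) F) (hg : g ∉ Subgroup.center (GL (Fin n) F)) :
    ∃ k ≤ 48, ∃ x y : Fin k → GL (Fin n) F,
      (∀ i, x i ∈ {c : GL (Fin n) F | ∃ s ∈ SLsub n F, c = s * g * s⁻¹}) ∧
      (∀ i, y i ∈ {c : GL (Fin n) F | ∃ s ∈ SLsub n F, c = s * g * s⁻¹}⁻¹) ∧
      (List.ofFn fun i => x i * y i).prod ∉ Subgroup.center (GL (Fin n) F) ∧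
      ((List.ofFn fun i => x i * y i).prod ^ 2 = 1 ∨
        (List.ofFn fun i => x i * y i).prod ^ 2 = -1) := by
  have hcard := Fintype.one_lt_card (α := F)
  obtain ⟨k, hk, t, ht, hcen, hsq⟩ := exists_sq_eq_of_notMem_center hn (by omega) hg
  obtain ⟨x, y, hx, hy, rfl⟩ := exists_ofFn_prod_of_mem_classQuotient_pow ht
  exact ⟨k, by omega, x, y, hx, hy, hcen, hsq⟩
end

section
/- Let F be a finite field. Then every matrix g ∈ SL_2(F) is conjugate by an element of SL_2(F) to a matrix which is either upper triangular (lower-left entry equal to 0) or has its (1,1)-entry equal to 0. -/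
theorem stmt_14 {F : Type*} [Field F] [Fintype F] (g : Matrix.SpecialLinearGroup (Fin 2) F) :
    ∃ s : Matrix.SpecialLinearGroup (Fin 2) F,
      ((s * g * s⁻¹ : Matrix.SpecialLinearGroup (Fin 2) F) : Matrix (Fin 2) (Fin 2) F) 1 0 = 0 ∨
      ((s * g * s⁻¹ : Matrix.SpecialLinearGroup (Fin 2) F) : Matrix (Fin 2) (Fin 2) F) 0 0 = 0 := by
  by_cases hc : (g : Matrix (Fin 2) (Fin 2) F) 1 0 = 0
  · exact ⟨1, Or.inl (by simpa using hc)⟩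
  · obtain ⟨s, hs⟩ : ∃ s : Matrix.SpecialLinearGroup (Fin 2) F,
        (s : Matrix (Fin 2) (Fin 2) F) =
          !![1, -((g : Matrix (Fin 2) (Fin 2) F) 0 0 / (g : Matrix (Fin 2) (Fin 2) F) 1 0); 0, 1] :=
      ⟨⟨_, by simp [Matrix.det_fin_two]⟩, rfl⟩
    refine ⟨s, Or.inr ?_⟩
    rw [Matrix.SpecialLinearGroup.coe_mul, Matrix.SpecialLinearGroup.coe_mul,
      Matrix.SpecialLinearGroup.coe_inv, hs, Matrix.adjugate_fin_two]
    simp [Matrix.vecMul, dotProduct, Matrix.mul_apply, div_mul_cancel₀ _ hc]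
end

section
/- Let F be a finite field with |F| = q, let n ≥ 2 with (n,q) ≠ (2,2) and (n,q) ≠ (2,3), and let g ∈ GL_n(F) \ Z(GL_n(F)). Then there exists h ∈ SL_n(F) such that the commutator [g,h] = g⁻¹h⁻¹gh lies in SL_n(F) but is not a scalar matrix, i.e. [g,h] ∈ SL_n(F) \ Z(GL_n(F)). -/
open scoped commutatorElement

/-- If `g` commutes with `a` and with `b` up to central elements, then it commutes
with their commutator. -/
lemma commute_commutatorElement_of_mem_center {G : Type*} [Group G] {g a b : G}
    (ha : g⁻¹ * a⁻¹ * g * a ∈ Subgroup.center G) (hb : g⁻¹ * b⁻¹ * g * b ∈ Subgroup.center G) :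
    Commute g ⁅a, b⁆ := by
  obtain ⟨z, hz⟩ : ∃ z, z = g⁻¹ * a⁻¹ * g * a := ⟨_, rfl⟩
  obtain ⟨w, hw⟩ : ∃ w, w = g⁻¹ * b⁻¹ * g * b := ⟨_, rfl⟩
  rw [← hz, Subgroup.mem_center_iff] at ha
  rw [← hw, Subgroup.mem_center_iff] at hb
  have conj_a : g * a * g⁻¹ = a * z := by
    rw [← mul_right_cancel_iff (a := g), mul_assoc a, ← ha g, hz]; group
  have conj_b : g * b * g⁻¹ = b * w := by
    rw [← mul_right_cancel_iff (a := g), mul_assoc b, ← hb g, hw]; group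
  have key : g * ⁅a, b⁆ * g⁻¹ = ⁅a, b⁆ := by
    calc g * ⁅a, b⁆ * g⁻¹
        = (g * a * g⁻¹) * (g * b * g⁻¹) * (g * a * g⁻¹)⁻¹ * (g * b * g⁻¹)⁻¹ := by
          rw [commutatorElement_def]; group
      _ = a * (z * b) * (w * z⁻¹) * a⁻¹ * w⁻¹ * b⁻¹ := by rw [conj_a, conj_b]; group
      _ = a * b * (z * w) * z⁻¹ * a⁻¹ * w⁻¹ * b⁻¹ := by rw [← ha b]; group
      _ = a * b * (w * a⁻¹) * w⁻¹ * b⁻¹ := by rw [← ha w]; group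
      _ = ⁅a, b⁆ := by rw [← hb a⁻¹, commutatorElement_def]; group
  exact mul_inv_eq_iff_eq_mul.mp key

lemma Matrix.SpecialLinearGroup.commutatorElement_transvection {ι F : Type*} [Fintype ι]
    [DecidableEq ι] [Field F] {i j k : ι} (hij : i ≠ j) (hik : i ≠ k) (hkj : k ≠ j) (c : F) :
    ⁅transvection hik c, transvection hkj 1⁆ = transvection hij c := by
  rw [commutatorElement_def, mul_inv_eq_iff_eq_mul, mul_inv_eq_iff_eq_mul]
  apply Subtype.ext
  simp [transvection_coe, mul_add, add_mul, hij.symm, hkj.symm]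
  abel

/-- A transvection lies in the commutator subgroup of `SL n F`, except over the fields with two or
three elements when `n = 2`. -/
lemma Matrix.SpecialLinearGroup.transvection_mem_commutator_of_two_le {F : Type*} [Field F]
    [Fintype F] {n : ℕ} (hn : 2 ≤ n) (h : n = 2 → 3 < Fintype.card F) {i j : Fin n} (hij : i ≠ j)
    (c : F) : transvection hij c ∈ commutator (SpecialLinearGroup (Fin n) F) := by
  classical
  obtain rfl | hn := hn.eq_or_lt
  · obtain ⟨a, -, ha⟩ : ∃ a ∈ Finset.univ, a ∉ ({0, 1, -1} : Finset F) :=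
      Finset.exists_mem_notMem_of_card_lt_card (Finset.card_le_three.trans_lt (h rfl))
    simp only [Finset.mem_insert, Finset.mem_singleton, not_or] at ha
    exact transvection_mem_commutator ha.1 (sq_ne_one_iff.mpr ha.2) hij c
  · obtain ⟨k, -, hk⟩ : ∃ k ∈ Finset.univ, k ∉ ({i, j} : Finset (Fin n)) :=
      Finset.exists_mem_notMem_of_card_lt_card (Finset.card_le_two.trans_lt (by simpa using hn))
    simp only [Finset.mem_insert, Finset.mem_singleton, not_or] at hk
    rw [← commutatorElement_transvection hij (Ne.symm hk.1) hk.2]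
    exact Subgroup.commutator_mem_commutator (Subgroup.mem_top _) (Subgroup.mem_top _)

theorem stmt_18 {F : Type*} [Field F] [Fintype F] {q n : ℕ} (hq : Fintype.card F = q)
    (hn : 2 ≤ n) (h22 : ¬(n = 2 ∧ q = 2)) (h23 : ¬(n = 2 ∧ q = 3))
    (g : GL (Fin n) F) (hg : g ∉ Subgroup.center (GL (Fin n) F)) :
    ∃ h : GL (Fin n) F, (h : Matrix (Fin n) (Fin n) F).det = 1 ∧
      ((g⁻¹ * h⁻¹ * g * h : GL (Fin n) F) : Matrix (Fin n) (Fin n) F).det = 1 ∧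
      g⁻¹ * h⁻¹ * g * h ∉ Subgroup.center (GL (Fin n) F) := by
  by_contra! H
  have det_comm (h : GL (Fin n) F) :
      ((g⁻¹ * h⁻¹ * g * h : GL (Fin n) F) : Matrix (Fin n) (Fin n) F).det = 1 := by
    rw [← Matrix.GeneralLinearGroup.val_det_apply]
    simp only [map_mul, map_inv]
    rw [mul_right_comm _ _ (Matrix.GeneralLinearGroup.det g)]
    simp
  have mem_center (s : Matrix.SpecialLinearGroup (Fin n) F) :
      g⁻¹ * (s.toGL)⁻¹ * g * s.toGL ∈ Subgroup.center (GL (Fin n) F) :=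
    H _ s.det_coe (det_comm _)
  have commutator_le : commutator (Matrix.SpecialLinearGroup (Fin n) F) ≤
      (Subgroup.centralizer {g}).comap Matrix.SpecialLinearGroup.toGL := by
    rw [commutator_def, Subgroup.commutator_le]
    intro a _ b _
    rw [Subgroup.mem_comap, Subgroup.mem_centralizer_singleton_iff, map_commutatorElement]
    exact (commute_commutatorElement_of_mem_center (mem_center a) (mem_center b)).symm
  have card_lt : n = 2 → 3 < Fintype.card F := by
    have := Fintype.one_lt_card (α := F)
    grind
  refine hg (Matrix.GeneralLinearGroup.mem_center_iff_val_mem_range_scalar.mpr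
    (Matrix.mem_range_scalar_of_commute_transvectionStruct fun t => ?_))
  have := commutator_le (Matrix.SpecialLinearGroup.transvection_mem_commutator_of_two_le
    hn card_lt t.hij t.c)
  rw [Subgroup.mem_comap, Subgroup.mem_centralizer_singleton_iff] at this
  exact congrArg Units.val this
end
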